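/- Under the assumptions of Theorem 1.1 (positive cylindrical weak solution (u,v) of −Δ_ℍu = f(v), −Δ_ℍv = g(u) with f,g continuous, nondecreasing on (0,∞), and f(t)/t^{(Q+2)/(Q−2)}, g(t)/t^{(Q+2)/(Q−2)} nonincreasing on (0,∞)), there exists λ₀ > 0 such that for all λ ≥ λ₀: U_λ(ξ) ≤ 0 and V_λ(ξ) ≤ 0 for all ξ ∈ Σ_λ∖{0_λ}. -/

import Mathlib

open MeasureTheory Real Filter Set Topology

noncomputable section

namespace Heisenberg

/-- The underlying space of the Heisenberg group `ℍⁿ`, identified with `ℝⁿ × ℝⁿ × ℝ`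
(equipped with Lebesgue measure, which is the Haar measure of `ℍⁿ`). -/
abbrev H (n : ℕ) : Type := (Fin n → ℝ) × (Fin n → ℝ) × ℝ

variable {n : ℕ}

/-- `|x|² + |y|²` for `ξ = (x, y, t)`. -/
def rsq (ξ : H n) : ℝ := ∑ i, (ξ.1 i) ^ 2 + ∑ i, (ξ.2.1 i) ^ 2

/-- The Kaplan gauge `|ξ|_ℍ = ((|x|²+|y|²)² + t²)^{1/4}`. -/
def gaugeH (ξ : H n) : ℝ := ((rsq ξ) ^ 2 + (ξ.2.2) ^ 2) ^ ((4 : ℝ)⁻¹)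

/-- The left-invariant vector field `Xᵢ = ∂_{xᵢ} + 2yᵢ∂_t` applied to `φ`. -/
def Xd (i : Fin n) (φ : H n → ℝ) (ξ : H n) : ℝ :=
  fderiv ℝ φ ξ (Pi.single i 1, 0, 2 * ξ.2.1 i)

/-- The left-invariant vector field `Yᵢ = ∂_{yᵢ} − 2xᵢ∂_t` applied to `φ`. -/
def Yd (i : Fin n) (φ : H n → ℝ) (ξ : H n) : ℝ :=
  fderiv ℝ φ ξ (0, Pi.single i 1, -(2 * ξ.1 i))

/-- The horizontal gradient `∇_ℍ φ = (X₁φ,…,Xₙφ,Y₁φ,…,Yₙφ)` of a differentiable function. -/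
def hGrad (φ : H n → ℝ) (ξ : H n) : (Fin n → ℝ) × (Fin n → ℝ) :=
  (fun i => Xd i φ ξ, fun i => Yd i φ ξ)

/-- Euclidean pairing of two horizontal vectors. -/
def hdot (a b : (Fin n → ℝ) × (Fin n → ℝ)) : ℝ :=
  ∑ i, a.1 i * b.1 i + ∑ i, a.2 i * b.2 i

/-- The (pointwise, classical) sub-Laplacian `Δ_ℍ = ∑ᵢ (Xᵢ² + Yᵢ²)`. -/
def subLap (u : H n → ℝ) (ξ : H n) : ℝ :=
  ∑ i, Xd i (Xd i u) ξ + ∑ i, Yd i (Yd i u) ξ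

/-- `φ ∈ C¹_c(Ω)`. -/
structure IsTest (Ω : Set (H n)) (φ : H n → ℝ) : Prop where
  contDiff : ContDiff ℝ 1 φ
  compactSupport : HasCompactSupport φ
  supportSubset : tsupport φ ⊆ Ω

/-- `G` is a weak horizontal gradient of `u` on `Ω`, with `u` locally integrable on `Ω`
and `G` locally square-integrable on `Ω` (i.e. `u ∈ H¹_loc(Ω)` with horizontal gradient `G`). -/
structure IsWeakHGrad (Ω : Set (H n)) (u : H n → ℝ)
    (G : H n → (Fin n → ℝ) × (Fin n → ℝ)) : Prop where
  locInt : LocallyIntegrableOn u Ω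
  locSq : ∀ K : Set (H n), K ⊆ Ω → IsCompact K → IntegrableOn (fun ξ => ‖G ξ‖ ^ 2) K
  ibpX : ∀ i : Fin n, ∀ φ : H n → ℝ, IsTest Ω φ →
    ∫ ξ, u ξ * Xd i φ ξ = -∫ ξ, (G ξ).1 i * φ ξ
  ibpY : ∀ i : Fin n, ∀ φ : H n → ℝ, IsTest Ω φ →
    ∫ ξ, u ξ * Yd i φ ξ = -∫ ξ, (G ξ).2 i * φ ξ

/-- `u ∈ H¹_loc(Ω)` is a weak solution of `−Δ_ℍ u = F` on `Ω`:
`∫ ∇_ℍu · ∇_ℍφ = ∫ F φ` for all `φ ∈ C¹_c(Ω)`. -/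
def IsWeakSol (Ω : Set (H n)) (u F : H n → ℝ) : Prop :=
  ∃ G : H n → (Fin n → ℝ) × (Fin n → ℝ), IsWeakHGrad Ω u G ∧
    ∀ φ : H n → ℝ, IsTest Ω φ → ∫ ξ, hdot (G ξ) (hGrad φ ξ) = ∫ ξ, F ξ * φ ξ

/-- A function on `ℍⁿ` is cylindrical if it depends only on `r = √(|x|²+|y|²)` and `t`. -/
def IsCylindrical (u : H n → ℝ) : Prop :=
  ∀ ξ ξ' : H n, rsq ξ = rsq ξ' → ξ.2.2 = ξ'.2.2 → u ξ = u ξ'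

/-- The CR-inverted point `ξ̃`. -/
def tilde (ξ : H n) : H n :=
  (fun i => (ξ.1 i * ξ.2.2 + ξ.2.1 i * rsq ξ) / gaugeH ξ ^ 4,
   fun i => (ξ.2.1 i * ξ.2.2 - ξ.1 i * rsq ξ) / gaugeH ξ ^ 4,
   -ξ.2.2 / gaugeH ξ ^ 4)

/-- The CR inversion `ū(ξ) = |ξ|_ℍ^{−(Q−2)} u(ξ̃)`, where `Q − 2 = 2n`. -/
def crInv (u : H n → ℝ) (ξ : H n) : ℝ := u (tilde ξ) / gaugeH ξ ^ (2 * n)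

/-- The critical exponent `τ = (Q+2)/(Q−2)` with `Q = 2n+2`. -/
def tau (n : ℕ) : ℝ := (2 * (n : ℝ) + 4) / (2 * (n : ℝ))

/-- The half space `Σ_λ = {ξ = (x,y,t) : t > λ}`. -/
def Sig (l : ℝ) : Set (H n) := {ξ | l < ξ.2.2}

/-- The H-reflection `ξ_λ = (y, x, 2λ − t)` with respect to the plane `T_λ = {t = λ}`. -/
def hRefl (l : ℝ) (ξ : H n) : H n := (ξ.2.1, ξ.1, 2 * l - ξ.2.2)

/-- The point `0_λ = (0, 0, 2λ)`. -/
def zl (l : ℝ) : H n := (0, 0, 2 * l)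

/-- `U_λ = ū − ū_λ`, where `ū` is the CR inversion of `u` and `ū_λ(ξ) = ū(ξ_λ)`. -/
def Ulam (u : H n → ℝ) (l : ℝ) (ξ : H n) : ℝ := crInv u ξ - crInv u (hRefl l ξ)

/-- `w ∈ L^{τ+1}(Σ_λ) ∩ L^∞(Σ_λ)`. -/
def MemLtau1Linf (l : ℝ) (w : H n → ℝ) : Prop :=
  IntegrableOn (fun ξ => |w ξ| ^ (tau n + 1)) (Sig l) ∧
    ∃ M : ℝ, ∀ ξ ∈ Sig (n := n) l, |w ξ| ≤ M

/-- `w ∈ H¹(Ω)`: square integrable on `Ω`, with a weak horizontal gradient which is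
square integrable on `Ω`. -/
def MemH1 (Ω : Set (H n)) (w : H n → ℝ) : Prop :=
  IntegrableOn (fun ξ => (w ξ) ^ 2) Ω ∧
  ∃ G : H n → (Fin n → ℝ) × (Fin n → ℝ),
    IntegrableOn (fun ξ => ‖G ξ‖ ^ 2) Ω ∧
    (∀ i : Fin n, ∀ φ : H n → ℝ, IsTest Ω φ →
      ∫ ξ, w ξ * Xd i φ ξ = -∫ ξ, (G ξ).1 i * φ ξ) ∧
    (∀ i : Fin n, ∀ φ : H n → ℝ, IsTest Ω φ →
      ∫ ξ, w ξ * Yd i φ ξ = -∫ ξ, (G ξ).2 i * φ ξ)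

end Heisenberg

section

open scoped ContDiff

namespace Heisenberg

/-- Open half plane of pairs `(s,t)`, `s = |x|^2+|y|^2`. -/
def HP : Set (ℝ × ℝ) := {p | 0 < p.1}

lemma isOpen_HP : IsOpen HP := isOpen_lt continuous_const continuous_fst

lemma measurableSet_HP : MeasurableSet HP := isOpen_HP.measurableSet

/-- `cosh d - 1` for the hyperbolic distance `d`. -/
def xx (q p : ℝ × ℝ) : ℝ := ((p.1 - q.1) ^ 2 + (p.2 - q.2) ^ 2) / (2 * p.1 * q.1)

structure Prof (Θ : ℝ → ℝ) : Prop where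
  smooth : ∃ κ > 0, ContDiffOn ℝ ∞ Θ (Ioi (-κ))
  supp : ∃ δ > 0, ∀ x, δ ≤ x → Θ x = 0

def AA (a : ℝ) (Θ : ℝ → ℝ) (x : ℝ) : ℝ :=
  (x ^ 2 + 2 * x) * deriv (deriv Θ) x + 2 * (1 + x) * deriv Θ x + a * (1 - a) * Θ x

def dS (ψ : ℝ × ℝ → ℝ) (p : ℝ × ℝ) : ℝ := fderiv ℝ ψ p (1, 0)
def dT (ψ : ℝ × ℝ → ℝ) (p : ℝ × ℝ) : ℝ := fderiv ℝ ψ p (0, 1)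

def tst (α : ℝ) (q : ℝ × ℝ) (Θ : ℝ → ℝ) (p : ℝ × ℝ) : ℝ :=
  if 0 < p.1 then p.1 ^ α * Θ (xx q p) else 0

lemma xx_nonneg {q p : ℝ × ℝ} (hq : q ∈ HP) (hp : p ∈ HP) : 0 ≤ xx q p := by
  have h1 : 0 < q.1 := hq
  have h2 : 0 < p.1 := hp
  unfold xx; positivity

lemma contDiffAt_xx {q p : ℝ × ℝ} (hq : q ∈ HP) (hp : p ∈ HP) : ContDiffAt ℝ ∞ (xx q) p := by
  have h1 : 0 < q.1 := hq
  have h2 : 0 < p.1 := hp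
  unfold xx
  apply ContDiffAt.div
  · fun_prop
  · fun_prop
  · positivity

lemma Prof.nhds_mem {κ x : ℝ} (hκ : 0 < κ) (hx : 0 ≤ x) : Ioi (-κ) ∈ 𝓝 x :=
  Ioi_mem_nhds (by linarith)

lemma Prof.contDiffAt {Θ : ℝ → ℝ} (h : Prof Θ) {x : ℝ} (hx : 0 ≤ x) : ContDiffAt ℝ ∞ Θ x := by
  obtain ⟨κ, hκ, h⟩ := h.smooth
  exact h.contDiffAt (Prof.nhds_mem hκ hx)

lemma Prof.deriv {Θ : ℝ → ℝ} (h : Prof Θ) : Prof (deriv Θ) := by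
  constructor
  · obtain ⟨κ, hκ, h⟩ := h.smooth
    exact ⟨κ, hκ, ((contDiffOn_infty_iff_deriv_of_isOpen isOpen_Ioi).1 h).2⟩
  · obtain ⟨δ, hδ, h⟩ := h.supp
    refine ⟨δ + 1, by linarith, fun x hx => ?_⟩
    have : Θ =ᶠ[𝓝 x] fun _ => 0 := by
      filter_upwards [Ioi_mem_nhds (show δ < x by linarith)] with y hy
      exact h y (le_of_lt hy)
    rw [this.deriv_eq]; simp

lemma Prof.hasDerivAt {Θ : ℝ → ℝ} (h : Prof Θ) {x : ℝ} (hx : 0 ≤ x) :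
    HasDerivAt Θ (_root_.deriv Θ x) x :=
  ((h.contDiffAt hx).differentiableAt (by simp)).hasDerivAt

lemma Prof.supp_all {Θ : ℝ → ℝ} (h : Prof Θ) : ∃ δ > 0, ∀ x, δ ≤ x →
    Θ x = 0 ∧ _root_.deriv Θ x = 0 ∧ _root_.deriv (_root_.deriv Θ) x = 0 := by
  obtain ⟨δ, h0, h1⟩ := h.supp
  obtain ⟨δ', h0', h1'⟩ := h.deriv.supp
  obtain ⟨δ'', h0'', h1''⟩ := h.deriv.deriv.supp
  refine ⟨max δ (max δ' δ''), by positivity, fun x hx => ?_⟩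
  simp only [max_le_iff] at hx
  exact ⟨h1 x hx.1, h1' x hx.2.1, h1'' x hx.2.2⟩

/-- A compact box of the half plane. -/
def box (q : ℝ × ℝ) (δ : ℝ) : Set (ℝ × ℝ) :=
  Icc (q.1 / (2 + 2 * δ)) ((2 + 2 * δ) * q.1) ×ˢ
    Icc (q.2 - (2 + 2 * δ) * q.1) (q.2 + (2 + 2 * δ) * q.1)

lemma isCompact_box (q : ℝ × ℝ) (δ : ℝ) : IsCompact (box q δ) := isCompact_Icc.prod isCompact_Icc

lemma box_subset {q : ℝ × ℝ} {δ : ℝ} (hq : q ∈ HP) (hδ : 0 ≤ δ) : box q δ ⊆ HP := by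
  intro p hp
  have h1 : 0 < q.1 := hq
  have : 0 < q.1 / (2 + 2 * δ) := by positivity
  exact lt_of_lt_of_le this hp.1.1

lemma mem_box {q p : ℝ × ℝ} {δ : ℝ} (hq : q ∈ HP) (hp : p ∈ HP) (hδ : 0 ≤ δ) (h : xx q p ≤ δ) :
    p ∈ box q δ := by
  have h1 : 0 < q.1 := hq
  have h2 : 0 < p.1 := hp
  unfold xx at h
  rw [div_le_iff₀ (by positivity)] at h
  have h3 : p.1 ^ 2 + q.1 ^ 2 + (p.2 - q.2) ^ 2 ≤ (2 + 2 * δ) * p.1 * q.1 := by nlinarith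
  have h4 : p.1 ≤ (2 + 2 * δ) * q.1 := by
    by_contra hc; push Not at hc
    nlinarith [sq_nonneg (p.2 - q.2), sq_pos_of_pos h1]
  have h5 : q.1 ≤ (2 + 2 * δ) * p.1 := by
    by_contra hc; push Not at hc
    nlinarith [sq_nonneg (p.2 - q.2), sq_pos_of_pos h2]
  have h6 : |p.2 - q.2| ≤ (2 + 2 * δ) * q.1 := by
    apply abs_le_of_sq_le_sq _ (by positivity)
    have : (2 + 2 * δ) * p.1 * q.1 ≤ (2 + 2 * δ) * ((2 + 2 * δ) * q.1) * q.1 := by gcongr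
    nlinarith [sq_nonneg p.1, sq_nonneg q.1]
  rw [abs_le] at h6
  refine ⟨⟨?_, h4⟩, ?_, ?_⟩
  · rw [div_le_iff₀ (by positivity)]; linarith
  · linarith [h6.1]
  · linarith [h6.2]

lemma tst_eq {α : ℝ} {q p : ℝ × ℝ} {Θ : ℝ → ℝ} (hp : p ∈ HP) :
    tst α q Θ p = p.1 ^ α * Θ (xx q p) := if_pos hp

lemma tst_zero {α : ℝ} {q p : ℝ × ℝ} {Θ : ℝ → ℝ} {δ : ℝ} (hδ : 0 ≤ δ) (hq : q ∈ HP)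
    (h : ∀ x, δ ≤ x → Θ x = 0) (hp : p ∉ box q δ) : tst α q Θ p = 0 := by
  unfold tst
  split_ifs with h1
  · rw [h, mul_zero]
    by_contra hc; push Not at hc
    exact hp (mem_box hq h1 hδ hc.le)
  · rfl

lemma contDiff_tst {α : ℝ} {q : ℝ × ℝ} {Θ : ℝ → ℝ} (hq : q ∈ HP) (h : Prof Θ) :
    ContDiff ℝ ∞ (tst α q Θ) := by
  rw [contDiff_iff_contDiffAt]
  intro p
  obtain ⟨δ, hδ, hs⟩ := h.supp
  by_cases hp : p ∈ HP
  · have : tst α q Θ =ᶠ[𝓝 p] fun p => p.1 ^ α * Θ (xx q p) := by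
      filter_upwards [isOpen_HP.mem_nhds hp] with y hy using tst_eq hy
    refine ContDiffAt.congr_of_eventuallyEq ?_ this
    have h2 : (0 : ℝ) < p.1 := hp
    refine (contDiffAt_fst.rpow_const_of_ne h2.ne').mul ?_
    exact (h.contDiffAt (xx_nonneg hq hp)).comp p (contDiffAt_xx hq hp)
  · have hb : p ∉ box q δ := fun hc => hp (box_subset hq hδ.le hc)
    have : tst α q Θ =ᶠ[𝓝 p] fun p => 0 := by
      filter_upwards [(isCompact_box q δ).isClosed.isOpen_compl.mem_nhds hb] with y hy
      exact tst_zero hδ.le hq hs hy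
    exact contDiffAt_const.congr_of_eventuallyEq this

lemma tsupport_tst {α : ℝ} {q : ℝ × ℝ} {Θ : ℝ → ℝ} {δ : ℝ} (hδ : 0 ≤ δ) (hq : q ∈ HP)
    (h : ∀ x, δ ≤ x → Θ x = 0) : tsupport (tst α q Θ) ⊆ box q δ := by
  apply closure_minimal _ (isCompact_box q δ).isClosed
  intro p hp
  by_contra hc
  exact hp (tst_zero hδ hq h hc)

lemma hasCompactSupport_tst {α : ℝ} {q : ℝ × ℝ} {Θ : ℝ → ℝ} (hq : q ∈ HP) (h : Prof Θ) :
    HasCompactSupport (tst α q Θ) := by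
  obtain ⟨δ, hδ, hs⟩ := h.supp
  exact (isCompact_box q δ).of_isClosed_subset (isClosed_tsupport _) (tsupport_tst hδ.le hq hs)

lemma tsupport_tst_HP {α : ℝ} {q : ℝ × ℝ} {Θ : ℝ → ℝ} (hq : q ∈ HP) (h : Prof Θ) :
    tsupport (tst α q Θ) ⊆ HP := by
  obtain ⟨δ, hδ, hs⟩ := h.supp
  exact (tsupport_tst hδ.le hq hs).trans (box_subset hq hδ.le)

def xs (q p : ℝ × ℝ) : ℝ := 1 / (2 * q.1) - (q.1 ^ 2 + (p.2 - q.2) ^ 2) / (2 * q.1 * p.1 ^ 2)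
def xss (q p : ℝ × ℝ) : ℝ := (q.1 ^ 2 + (p.2 - q.2) ^ 2) / (q.1 * p.1 ^ 3)
def xt (q p : ℝ × ℝ) : ℝ := (p.2 - q.2) / (p.1 * q.1)

lemma hasDerivAt_xx_s {q : ℝ × ℝ} {s t : ℝ} (hq : q ∈ HP) (hs : 0 < s) :
    HasDerivAt (fun σ => xx q (σ, t)) (xs q (s, t)) s := by
  have h1 : 0 < q.1 := hq
  unfold xx xs
  simp only
  have := ((((hasDerivAt_id s).sub_const q.1).pow 2).add_const ((t - q.2) ^ 2)).div
    (((hasDerivAt_id s).const_mul 2).mul_const q.1) (by simp; constructor <;> positivity)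
  refine this.congr_deriv ?_
  simp
  field_simp
  ring

lemma hasDerivAt_xs_s {q : ℝ × ℝ} {s t : ℝ} (hq : q ∈ HP) (hs : 0 < s) :
    HasDerivAt (fun σ => xs q (σ, t)) (xss q (s, t)) s := by
  have h1 : 0 < q.1 := hq
  unfold xs xss
  simp only
  have := ((hasDerivAt_const s (q.1 ^ 2 + (t - q.2) ^ 2)).div
    (((hasDerivAt_id s).pow 2).const_mul (2 * q.1)) (by simp; constructor <;> positivity)).const_sub
      (1 / (2 * q.1))
  refine this.congr_deriv ?_
  simp
  field_simp

lemma hasDerivAt_xx_t {q : ℝ × ℝ} {s t : ℝ} (hq : q ∈ HP) (hs : 0 < s) :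
    HasDerivAt (fun σ => xx q (s, σ)) (xt q (s, t)) t := by
  have h1 : 0 < q.1 := hq
  unfold xx xt
  simp only
  have := ((((hasDerivAt_id t).sub_const q.2).pow 2).const_add ((s - q.1) ^ 2)).div_const
    (2 * s * q.1)
  refine this.congr_deriv ?_
  simp
  field_simp

lemma hasDerivAt_xt_t {q : ℝ × ℝ} {s t : ℝ} (_ : q ∈ HP) (_ : 0 < s) :
    HasDerivAt (fun σ => xt q (s, σ)) (1 / (s * q.1)) t := by
  unfold xt
  simpa using (((hasDerivAt_id t).sub_const q.2)).div_const (s * q.1)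

lemma xx_grad {q p : ℝ × ℝ} (hq : q ∈ HP) (hp : p ∈ HP) :
    p.1 ^ 2 * (xs q p ^ 2 + xt q p ^ 2) = xx q p ^ 2 + 2 * xx q p := by
  have h1 : 0 < q.1 := hq
  have h2 : 0 < p.1 := hp
  unfold xs xt xx
  field_simp
  ring

lemma xx_lap {q p : ℝ × ℝ} (hq : q ∈ HP) (hp : p ∈ HP) :
    p.1 ^ 2 * (xss q p + 1 / (p.1 * q.1)) = 2 * (1 + xx q p) := by
  have h1 : 0 < q.1 := hq
  have h2 : 0 < p.1 := hp
  unfold xss xx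
  field_simp
  ring

lemma dS_eq {ψ : ℝ × ℝ → ℝ} {p : ℝ × ℝ} {d : ℝ} (hψ : DifferentiableAt ℝ ψ p)
    (h : HasDerivAt (fun σ => ψ (σ, p.2)) d p.1) : dS ψ p = d := by
  have h1 : HasDerivAt (fun σ : ℝ => (σ, p.2)) ((1 : ℝ), (0 : ℝ)) p.1 :=
    (hasDerivAt_id p.1).prodMk (hasDerivAt_const p.1 p.2)
  have h2 := (show HasFDerivAt ψ (fderiv ℝ ψ p) (p.1, p.2) from hψ.hasFDerivAt).comp_hasDerivAt
    p.1 h1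
  exact h2.unique h

lemma dT_eq {ψ : ℝ × ℝ → ℝ} {p : ℝ × ℝ} {d : ℝ} (hψ : DifferentiableAt ℝ ψ p)
    (h : HasDerivAt (fun σ => ψ (p.1, σ)) d p.2) : dT ψ p = d := by
  have h1 : HasDerivAt (fun σ : ℝ => (p.1, σ)) ((0 : ℝ), (1 : ℝ)) p.2 :=
    (hasDerivAt_const p.2 p.1).prodMk (hasDerivAt_id p.2)
  have h2 := (show HasFDerivAt ψ (fderiv ℝ ψ p) (p.1, p.2) from hψ.hasFDerivAt).comp_hasDerivAt
    p.2 h1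
  exact h2.unique h

lemma contDiff_dS {ψ : ℝ × ℝ → ℝ} (h : ContDiff ℝ ∞ ψ) : ContDiff ℝ ∞ (dS ψ) :=
  (h.fderiv_right (by simp)).clm_apply contDiff_const

lemma contDiff_dT {ψ : ℝ × ℝ → ℝ} (h : ContDiff ℝ ∞ ψ) : ContDiff ℝ ∞ (dT ψ) :=
  (h.fderiv_right (by simp)).clm_apply contDiff_const

lemma tsupport_dS (ψ : ℝ × ℝ → ℝ) : tsupport (dS ψ) ⊆ tsupport ψ :=
  tsupport_fderiv_apply_subset ℝ _

lemma tsupport_dT (ψ : ℝ × ℝ → ℝ) : tsupport (dT ψ) ⊆ tsupport ψ :=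
  tsupport_fderiv_apply_subset ℝ _

variable {α : ℝ} {q p : ℝ × ℝ} {Θ : ℝ → ℝ}

lemma dS_tst (hq : q ∈ HP) (h : Prof Θ) (hp : p ∈ HP) : dS (tst α q Θ) p =
    α * p.1 ^ (α - 1) * Θ (xx q p) + p.1 ^ α * (deriv Θ (xx q p) * xs q p) := by
  have h2 : 0 < p.1 := hp
  apply dS_eq ((contDiff_tst hq h).differentiable (by simp) p)
  have e : (fun σ => tst α q Θ (σ, p.2)) =ᶠ[𝓝 p.1] fun σ => σ ^ α * Θ (xx q (σ, p.2)) := by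
    filter_upwards [Ioi_mem_nhds h2] with y hy using tst_eq (p := (y, p.2)) hy
  refine HasDerivAt.congr_of_eventuallyEq ?_ e
  exact (hasDerivAt_rpow_const (Or.inl h2.ne')).mul
    ((h.hasDerivAt (xx_nonneg hq hp)).comp p.1 (hasDerivAt_xx_s hq h2))

lemma dSS_tst (hq : q ∈ HP) (h : Prof Θ) (hp : p ∈ HP) : dS (dS (tst α q Θ)) p =
    α * (α - 1) * p.1 ^ (α - 2) * Θ (xx q p) + 2 * α * p.1 ^ (α - 1) * (deriv Θ (xx q p) * xs q p)
    + p.1 ^ α * (deriv (deriv Θ) (xx q p) * xs q p ^ 2 + deriv Θ (xx q p) * xss q p) := by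
  have h2 : 0 < p.1 := hp
  apply dS_eq ((contDiff_dS (contDiff_tst hq h)).differentiable (by simp) p)
  have e : (fun σ => dS (tst α q Θ) (σ, p.2)) =ᶠ[𝓝 p.1] fun σ =>
      α * σ ^ (α - 1) * Θ (xx q (σ, p.2)) +
        σ ^ α * (deriv Θ (xx q (σ, p.2)) * xs q (σ, p.2)) := by
    filter_upwards [Ioi_mem_nhds h2] with y hy using dS_tst (p := (y, p.2)) hq h hy
  refine HasDerivAt.congr_of_eventuallyEq ?_ e
  have r1 := hasDerivAt_rpow_const (p := α) (Or.inl h2.ne')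
  have r2 := hasDerivAt_rpow_const (p := α - 1) (Or.inl h2.ne')
  have t1 := ((h.hasDerivAt (xx_nonneg hq hp)).comp p.1 (hasDerivAt_xx_s (t := p.2) hq h2))
  have t2 := ((h.deriv.hasDerivAt (xx_nonneg hq hp)).comp p.1 (hasDerivAt_xx_s (t := p.2) hq h2))
  have := ((r2.const_mul α).mul t1).add (r1.mul (t2.mul (hasDerivAt_xs_s (t := p.2) hq h2)))
  refine this.congr_deriv ?_
  simp only [Function.comp_apply, Pi.mul_apply, Pi.add_apply]
  rw [show α - 1 - 1 = α - 2 by ring]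
  ring

lemma dT_tst (hq : q ∈ HP) (h : Prof Θ) (hp : p ∈ HP) : dT (tst α q Θ) p =
    p.1 ^ α * (deriv Θ (xx q p) * xt q p) := by
  have h2 : 0 < p.1 := hp
  apply dT_eq ((contDiff_tst hq h).differentiable (by simp) p)
  have e : (fun σ => tst α q Θ (p.1, σ)) =ᶠ[𝓝 p.2] fun σ => p.1 ^ α * Θ (xx q (p.1, σ)) :=
    Eventually.of_forall fun y => tst_eq (p := (p.1, y)) h2
  refine HasDerivAt.congr_of_eventuallyEq ?_ e
  exact ((h.hasDerivAt (xx_nonneg hq hp)).comp p.2 (hasDerivAt_xx_t hq h2)).const_mul _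

lemma dTT_tst (hq : q ∈ HP) (h : Prof Θ) (hp : p ∈ HP) : dT (dT (tst α q Θ)) p =
    p.1 ^ α * (deriv (deriv Θ) (xx q p) * xt q p ^ 2 + deriv Θ (xx q p) * (1 / (p.1 * q.1))) := by
  have h2 : 0 < p.1 := hp
  apply dT_eq ((contDiff_dT (contDiff_tst hq h)).differentiable (by simp) p)
  have e : (fun σ => dT (tst α q Θ) (p.1, σ)) =ᶠ[𝓝 p.2] fun σ =>
      p.1 ^ α * (deriv Θ (xx q (p.1, σ)) * xt q (p.1, σ)) :=
    Eventually.of_forall fun y => dT_tst (p := (p.1, y)) hq h h2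
  refine HasDerivAt.congr_of_eventuallyEq ?_ e
  have t2 := ((h.deriv.hasDerivAt (xx_nonneg hq hp)).comp p.2 (hasDerivAt_xx_t (s := p.1) hq h2))
  refine ((t2.mul (hasDerivAt_xt_t (s := p.1) hq h2)).const_mul _).congr_deriv ?_
  simp only [Function.comp_apply, Pi.mul_apply, Pi.add_apply]
  ring

/-- The operator `sΔ + 2a ∂_s` on `s^{-a} Θ(xx)`. -/
lemma P_tst {a : ℝ} (hq : q ∈ HP) (h : Prof Θ) (hp : p ∈ HP) :
    p.1 * (dS (dS (tst (-a) q Θ)) p + dT (dT (tst (-a) q Θ)) p) + 2 * a * dS (tst (-a) q Θ) p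
    = p.1 ^ (-a - 1) * AA a Θ (xx q p) := by
  have h2 : 0 < p.1 := hp
  rw [dSS_tst hq h hp, dTT_tst hq h hp, dS_tst hq h hp]
  have e1 : p.1 ^ (-a - 1) = p.1 ^ (-a - 2) * p.1 := by
    rw [← rpow_add_one h2.ne']; congr 1; ring
  have e2 : p.1 ^ (-a) = p.1 ^ (-a - 2) * p.1 ^ 2 := by
    rw [← rpow_natCast, ← rpow_add h2]; congr 1; push_cast; ring
  rw [e1, e2]
  unfold AA
  rw [← xx_grad hq hp, ← xx_lap hq hp]
  ring

lemma lap_tst (a : ℝ) (hq : q ∈ HP) (h : Prof Θ) (hp : p ∈ HP) :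
    dS (dS (tst 0 q Θ)) p + dT (dT (tst 0 q Θ)) p + a * (1 - a) / p.1 ^ 2 * tst 0 q Θ p
    = AA a Θ (xx q p) / p.1 ^ 2 := by
  have h2 : 0 < p.1 := hp
  rw [dSS_tst hq h hp, dTT_tst hq h hp, tst_eq hp]
  unfold AA
  rw [← xx_grad hq hp, ← xx_lap hq hp]
  simp
  field_simp
  ring

end Heisenberg

end

section

open scoped ContDiff

namespace Heisenberg

def WeakEq (a : ℝ) (y F : ℝ × ℝ → ℝ) : Prop :=
  ∀ q ∈ HP, ∀ Θ : ℝ → ℝ, Prof Θ →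
    ∫ p in HP, y p * (AA a Θ (xx q p) / p.1 ^ 2) = ∫ p in HP, F p * (Θ (xx q p) / p.1 ^ 2)

lemma integrableOn_HP {q : ℝ × ℝ} (hq : q ∈ HP) {y : ℝ × ℝ → ℝ} (hy : ContinuousOn y HP)
    {h : ℝ → ℝ} (hh : ContinuousOn h (Ici 0)) {δ : ℝ} (hδ : 0 ≤ δ) (hz : ∀ x, δ ≤ x → h x = 0) :
    IntegrableOn (fun p => y p * (h (xx q p) / p.1 ^ 2)) HP := by
  have hc : ContinuousOn (fun p => y p * (h (xx q p) / p.1 ^ 2)) HP := by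
    refine hy.mul (ContinuousOn.div ?_ (by fun_prop) ?_)
    · refine hh.comp (fun p hp => (contDiffAt_xx hq hp).continuousAt.continuousWithinAt) ?_
      exact fun p hp => xx_nonneg hq hp
    · intro p hp
      have : 0 < p.1 := hp
      positivity
  have h1 := (hc.mono (box_subset hq hδ)).integrableOn_compact (μ := volume) (isCompact_box q δ)
  refine h1.of_forall_sdiff_eq_zero measurableSet_HP ?_
  rintro p ⟨hp, hb⟩
  rw [hz, zero_div, mul_zero]
  by_contra hc; push Not at hc
  exact hb (mem_box hq hp hδ hc.le)

lemma Prof.continuousOn {Θ : ℝ → ℝ} (h : Prof Θ) : ContinuousOn Θ (Ici 0) :=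
  fun _ hx => (h.contDiffAt hx).continuousAt.continuousWithinAt

lemma Prof.continuousOn_AA {Θ : ℝ → ℝ} (h : Prof Θ) (a : ℝ) : ContinuousOn (AA a Θ) (Ici 0) := by
  have h0 := h.continuousOn
  have h1 := h.deriv.continuousOn
  have h2 := h.deriv.deriv.continuousOn
  unfold AA
  fun_prop

lemma Prof.int_AA {a : ℝ} {Θ : ℝ → ℝ} (h : Prof Θ) {q : ℝ × ℝ} (hq : q ∈ HP)
    {y : ℝ × ℝ → ℝ} (hy : ContinuousOn y HP) :
    IntegrableOn (fun p => y p * (AA a Θ (xx q p) / p.1 ^ 2)) HP := by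
  obtain ⟨δ, hδ, hz⟩ := h.supp_all
  refine integrableOn_HP hq hy (h.continuousOn_AA a) hδ.le (fun x hx => ?_)
  obtain ⟨h1, h2, h3⟩ := hz x hx
  simp [AA, h1, h2, h3]

lemma Prof.int_self {Θ : ℝ → ℝ} (h : Prof Θ) {q : ℝ × ℝ} (hq : q ∈ HP)
    {y : ℝ × ℝ → ℝ} (hy : ContinuousOn y HP) :
    IntegrableOn (fun p => y p * (Θ (xx q p) / p.1 ^ 2)) HP := by
  obtain ⟨δ, hδ, hz⟩ := h.supp
  exact integrableOn_HP hq hy h.continuousOn hδ.le hz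

lemma WeakEq.sub {a : ℝ} {y F y' F' : ℝ × ℝ → ℝ} (h : WeakEq a y F) (h' : WeakEq a y' F')
    (c1 : ContinuousOn y HP) (c2 : ContinuousOn y' HP) (c3 : ContinuousOn F HP)
    (c4 : ContinuousOn F' HP) : WeakEq a (fun p => y p - y' p) (fun p => F p - F' p) := by
  intro q hq Θ hΘ
  simp only [sub_mul]
  rw [integral_sub (hΘ.int_AA hq c1) (hΘ.int_AA hq c2),
    integral_sub (hΘ.int_self hq c3) (hΘ.int_self hq c4), h q hq Θ hΘ, h' q hq Θ hΘ]

lemma WeakEq.neg {a : ℝ} {y F : ℝ × ℝ → ℝ} (h : WeakEq a y F) :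
    WeakEq a (fun p => - y p) (fun p => - F p) := by
  intro q hq Θ hΘ
  simp only [neg_mul, integral_neg]
  rw [h q hq Θ hΘ]

/-- products of a function continuous on `HP` with a compactly supported function. -/
lemma integrable_mul_cs {η ψ : ℝ × ℝ → ℝ} (hη : ContinuousOn η HP) (hψ : Continuous ψ)
    (hc : HasCompactSupport ψ) (hs : tsupport ψ ⊆ HP) : Integrable (fun p => η p * ψ p) := by
  have h1 : IntegrableOn (fun p => η p * ψ p) (tsupport ψ) :=
    ((hη.mono hs).mul hψ.continuousOn).integrableOn_compact hc
  refine (integrableOn_iff_integrable_of_support_subset ?_).1 h1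
  intro p hp
  apply subset_tsupport
  intro h0
  exact hp (by simp [h0])

lemma ibp_aux {η η' ψ : ℝ × ℝ → ℝ} (v : ℝ × ℝ) (hη : ∀ p ∈ HP, DifferentiableAt ℝ η p)
    (hη' : ∀ p ∈ HP, fderiv ℝ η p v = η' p) (hc' : ContinuousOn η' HP)
    (hψ : ContDiff ℝ ∞ ψ)
    (hc : HasCompactSupport ψ) (hs : tsupport ψ ⊆ HP) :
    ∫ p, η p * fderiv ℝ ψ p v = - ∫ p, η' p * ψ p := by
  have hηc : ContinuousOn η HP := fun p hp => (hη p hp).continuousAt.continuousWithinAt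
  have e : ∀ p, fderiv ℝ η p v * ψ p = η' p * ψ p := by
    intro p
    by_cases hp : p ∈ HP
    · rw [hη' p hp]
    · have : ψ p = 0 := image_eq_zero_of_notMem_tsupport fun h => hp (hs h)
      simp [this]
  have hd : Continuous (fun p => fderiv ℝ ψ p v) :=
    ((hψ.fderiv_right (m := ∞) (by simp)).clm_apply contDiff_const).continuous
  rw [integral_mul_fderiv_eq_neg_fderiv_mul_of_integrable]
  · congr 2; funext p; exact e p
  · simp only [e]
    exact integrable_mul_cs hc' hψ.continuous hc hs
  · refine integrable_mul_cs hηc hd ?_ ?_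
    · exact hc.of_isClosed_subset (isClosed_tsupport _) (tsupport_fderiv_apply_subset ℝ _)
    · exact (tsupport_fderiv_apply_subset ℝ _).trans hs
  · exact integrable_mul_cs hηc hψ.continuous hc hs
  · exact fun p hp => hη p (hs hp)
  · exact fun p _ => hψ.differentiable (by simp) p

lemma fderiv_fst_comp {η η' : ℝ → ℝ} (h : ∀ s, 0 < s → HasDerivAt η (η' s) s) (p : ℝ × ℝ)
    (hp : p ∈ HP) : HasFDerivAt (fun p : ℝ × ℝ => η p.1)
      (η' p.1 • ContinuousLinearMap.fst ℝ ℝ ℝ) p :=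
  (h p.1 hp).comp_hasFDerivAt p hasFDerivAt_fst

lemma to_univ {F G : ℝ × ℝ → ℝ} (h1 : ∀ p ∈ HP, F p = G p) (h2 : ∀ p, p ∉ HP → G p = 0) :
    ∫ p in HP, F p = ∫ p, G p := by
  rw [setIntegral_congr_fun measurableSet_HP h1]
  exact setIntegral_eq_integral_of_forall_compl_eq_zero h2

lemma WeakEq.barrier (a : ℝ) {η η' η'' : ℝ → ℝ} (h : ∀ s, 0 < s → HasDerivAt η (η' s) s)
    (h' : ∀ s, 0 < s → HasDerivAt η' (η'' s) s) (hc : ContinuousOn η'' (Ioi 0)) :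
    WeakEq a (fun p => η p.1) (fun p => p.1 ^ 2 * η'' p.1 + a * (1 - a) * η p.1) := by
  intro q hq Θ hΘ
  set ψ := tst 0 q Θ with hψ
  have sm : ContDiff ℝ ∞ ψ := contDiff_tst hq hΘ
  have cs : HasCompactSupport ψ := hasCompactSupport_tst hq hΘ
  have ss : tsupport ψ ⊆ HP := tsupport_tst_HP hq hΘ
  have cη : ContinuousOn (fun p : ℝ × ℝ => η p.1) HP := fun p hp =>
    (fderiv_fst_comp h p hp).continuousAt.continuousWithinAt
  have cη' : ContinuousOn (fun p : ℝ × ℝ => η' p.1) HP := fun p hp =>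
    (fderiv_fst_comp h' p hp).continuousAt.continuousWithinAt
  have cη'' : ContinuousOn (fun p : ℝ × ℝ => η'' p.1) HP :=
    hc.comp continuousOn_fst (fun p hp => hp)
  have csS : HasCompactSupport (dS ψ) := cs.of_isClosed_subset (isClosed_tsupport _) (tsupport_dS ψ)
  have csT : HasCompactSupport (dT ψ) := cs.of_isClosed_subset (isClosed_tsupport _) (tsupport_dT ψ)
  have csSS : HasCompactSupport (dS (dS ψ)) :=
    csS.of_isClosed_subset (isClosed_tsupport _) (tsupport_dS _)
  have csTT : HasCompactSupport (dT (dT ψ)) :=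
    csT.of_isClosed_subset (isClosed_tsupport _) (tsupport_dT _)
  have i1 : ∫ p : ℝ × ℝ, η p.1 * dS (dS ψ) p = - ∫ p : ℝ × ℝ, η' p.1 * dS ψ p :=
    ibp_aux (1, 0) (fun p hp => (fderiv_fst_comp h p hp).differentiableAt)
      (fun p hp => by rw [(fderiv_fst_comp h p hp).fderiv]; simp) cη' (contDiff_dS sm) csS
      ((tsupport_dS ψ).trans ss)
  have i2 : ∫ p : ℝ × ℝ, η' p.1 * dS ψ p = - ∫ p : ℝ × ℝ, η'' p.1 * ψ p :=
    ibp_aux (1, 0) (fun p hp => (fderiv_fst_comp h' p hp).differentiableAt)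
      (fun p hp => by rw [(fderiv_fst_comp h' p hp).fderiv]; simp) cη'' sm cs ss
  have i3 : ∫ p : ℝ × ℝ, η p.1 * dT (dT ψ) p = - ∫ p : ℝ × ℝ, (0 : ℝ) * dT ψ p :=
    ibp_aux (η' := fun _ => 0) (0, 1) (fun p hp => (fderiv_fst_comp h p hp).differentiableAt)
      (fun p hp => by rw [(fderiv_fst_comp h p hp).fderiv]; simp) continuousOn_const
      (contDiff_dT sm) csT ((tsupport_dT ψ).trans ss)
  have z : ∀ p, p ∉ HP → ψ p = 0 := fun p hp =>
    image_eq_zero_of_notMem_tsupport fun h => hp (ss h)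
  have zS : ∀ p, p ∉ HP → dS (dS ψ) p = 0 := fun p hp =>
    image_eq_zero_of_notMem_tsupport fun h => hp (ss (tsupport_dS _ (tsupport_dS _ h)))
  have zT : ∀ p, p ∉ HP → dT (dT ψ) p = 0 := fun p hp =>
    image_eq_zero_of_notMem_tsupport fun h => hp (ss (tsupport_dT _ (tsupport_dT _ h)))
  have cq : ContinuousOn (fun p : ℝ × ℝ => η p.1 * (a * (1 - a) / p.1 ^ 2)) HP := by
    refine cη.mul (ContinuousOn.div (by fun_prop) (by fun_prop) ?_)
    intro p hp
    have : 0 < p.1 := hp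
    positivity
  have L : ∫ p in HP, η p.1 * (AA a Θ (xx q p) / p.1 ^ 2) =
      ∫ p : ℝ × ℝ, (η p.1 * dS (dS ψ) p + η p.1 * dT (dT ψ) p +
        η p.1 * (a * (1 - a) / p.1 ^ 2) * ψ p) := by
    refine to_univ (fun p hp => ?_) ?_
    · rw [← lap_tst a hq hΘ hp]; ring
    · intro p hp
      rw [z p hp, zS p hp, zT p hp]; ring
  have R : ∫ p in HP, (p.1 ^ 2 * η'' p.1 + a * (1 - a) * η p.1) * (Θ (xx q p) / p.1 ^ 2) =
      ∫ p : ℝ × ℝ, (η'' p.1 * ψ p + η p.1 * (a * (1 - a) / p.1 ^ 2) * ψ p) := by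
    refine to_univ (fun p hp => ?_) ?_
    · have : 0 < p.1 := hp
      rw [hψ, tst_eq hp, rpow_zero]; field_simp
    · intro p hp
      rw [z p hp]; ring
  have j1 := integrable_mul_cs cη (contDiff_dS (contDiff_dS sm)).continuous csSS
    ((tsupport_dS _).trans ((tsupport_dS _).trans ss))
  have j2 := integrable_mul_cs cη (contDiff_dT (contDiff_dT sm)).continuous csTT
    ((tsupport_dT _).trans ((tsupport_dT _).trans ss))
  have j3 := integrable_mul_cs cq sm.continuous cs ss
  have j12 : Integrable (fun p : ℝ × ℝ => η p.1 * dS (dS ψ) p + η p.1 * dT (dT ψ) p) := j1.add j2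
  have j4 := integrable_mul_cs cη'' sm.continuous cs ss
  rw [L, R, integral_add j12 j3, integral_add j1 j2, integral_add j4 j3, i1, i2, i3]
  simp

end Heisenberg

end

section

open scoped ContDiff

namespace Heisenberg

/-- squared distance to the boundary point `(0,c)`. -/
def DD (c : ℝ) (p : ℝ × ℝ) : ℝ := p.1 ^ 2 + (p.2 - c) ^ 2

/-- inversion in the circle of centre `(0,c)` and radius `ρ`. -/
def TT (c ρ : ℝ) (p : ℝ × ℝ) : ℝ × ℝ :=
  (ρ ^ 2 * p.1 / DD c p, c + ρ ^ 2 * (p.2 - c) / DD c p)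

lemma DD_pos {c : ℝ} {p : ℝ × ℝ} (hp : p ∈ HP) : 0 < DD c p := by
  have h2 : 0 < p.1 := hp
  unfold DD; positivity

lemma DD_nonneg (c : ℝ) (p : ℝ × ℝ) : 0 ≤ DD c p := by
  unfold DD; positivity

lemma continuous_DD (c : ℝ) : Continuous (DD c) := by
  unfold DD; fun_prop

lemma TT_mem {c ρ : ℝ} (hρ : 0 < ρ) {p : ℝ × ℝ} (hp : p ∈ HP) : TT c ρ p ∈ HP := by
  have h2 : 0 < p.1 := hp
  have := DD_pos (c := c) hp
  show 0 < ρ ^ 2 * p.1 / DD c p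
  positivity

lemma DD_TT {c ρ : ℝ} {p : ℝ × ℝ} (hp : 0 < DD c p) :
    DD c (TT c ρ p) = ρ ^ 4 / DD c p := by
  have e : DD c (TT c ρ p) = (ρ ^ 2 * p.1 / DD c p) ^ 2 + (ρ ^ 2 * (p.2 - c) / DD c p) ^ 2 := by
    simp [DD, TT]
  rw [e]
  have h3 : p.1 ^ 2 + (p.2 - c) ^ 2 = DD c p := rfl
  field_simp
  linear_combination ρ ^ 4 * h3

lemma TT_TT {c ρ : ℝ} (hρ : 0 < ρ) {p : ℝ × ℝ} (hp : 0 < DD c p) :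
    TT c ρ (TT c ρ p) = p := by
  have e := DD_TT (ρ := ρ) hp
  ext
  · show ρ ^ 2 * (ρ ^ 2 * p.1 / DD c p) / DD c (TT c ρ p) = p.1
    rw [e]; field_simp
  · show c + ρ ^ 2 * ((c + ρ ^ 2 * (p.2 - c) / DD c p) - c) / DD c (TT c ρ p) = p.2
    rw [e]; field_simp; ring

lemma xx_TT {c ρ : ℝ} (hρ : 0 < ρ) {q p : ℝ × ℝ} (hq : q ∈ HP) (hp : p ∈ HP) :
    xx (TT c ρ q) (TT c ρ p) = xx q p := by
  have h1 : 0 < q.1 := hq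
  have h2 : 0 < p.1 := hp
  have d1 := DD_pos (c := c) hp
  have d2 := DD_pos (c := c) hq
  have h3 : p.1 ^ 2 + (p.2 - c) ^ 2 = DD c p := rfl
  have h4 : q.1 ^ 2 + (q.2 - c) ^ 2 = DD c q := rfl
  simp only [xx, TT]
  field_simp
  generalize DD c p = P at *
  generalize DD c q = R at *
  linear_combination ρ ^ 4 * (R ^ 2 * h3 + P ^ 2 * h4 - P * R * h3 - P * R * h4)

lemma xx_TT' {c ρ : ℝ} (hρ : 0 < ρ) {q p : ℝ × ℝ} (hq : q ∈ HP) (hp : p ∈ HP) :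
    xx q (TT c ρ p) = xx (TT c ρ q) p := by
  rw [← xx_TT (c := c) hρ (TT_mem hρ hq) hp, TT_TT hρ (DD_pos hq)]

def TTd (c ρ : ℝ) (p : ℝ × ℝ) : ℝ × ℝ →L[ℝ] ℝ × ℝ :=
  (Matrix.toLin (.finTwoProd ℝ) (.finTwoProd ℝ)
    !![ρ ^ 2 / DD c p ^ 2 * (DD c p - 2 * p.1 ^ 2), ρ ^ 2 / DD c p ^ 2 * (-2 * p.1 * (p.2 - c));
      ρ ^ 2 / DD c p ^ 2 * (-2 * p.1 * (p.2 - c)),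
      ρ ^ 2 / DD c p ^ 2 * (DD c p - 2 * (p.2 - c) ^ 2)]).toContinuousLinearMap

lemma det_TTd {c ρ : ℝ} {p : ℝ × ℝ} (hp : p ∈ HP) : (TTd c ρ p).det = - (ρ ^ 4 / DD c p ^ 2) := by
  have d1 := DD_pos (c := c) hp
  have h3 : p.1 ^ 2 + (p.2 - c) ^ 2 = DD c p := rfl
  unfold TTd
  simp only [LinearMap.det_toContinuousLinearMap, LinearMap.det_toLin, Matrix.det_fin_two_of]
  field_simp
  generalize DD c p = P at *
  linear_combination ρ ^ 4 * (-2 * P * h3)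

lemma hasFDerivAt_DD (c : ℝ) (p : ℝ × ℝ) : HasFDerivAt (DD c)
    ((2 * p.1) • ContinuousLinearMap.fst ℝ ℝ ℝ + (2 * (p.2 - c)) • ContinuousLinearMap.snd ℝ ℝ ℝ)
    p := by
  have h1 : HasFDerivAt (fun p : ℝ × ℝ => p.1) (ContinuousLinearMap.fst ℝ ℝ ℝ) p := hasFDerivAt_fst
  have h2 : HasFDerivAt (fun p : ℝ × ℝ => p.2 - c) (ContinuousLinearMap.snd ℝ ℝ ℝ) p :=
    hasFDerivAt_snd.sub_const c
  have := (h1.pow 2).add (h2.pow 2)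
  unfold DD
  convert! this using 1
  simp

lemma hasFDerivAt_TT {c ρ : ℝ} {p : ℝ × ℝ} (hp : p ∈ HP) :
    HasFDerivAt (TT c ρ) (TTd c ρ p) p := by
  have d1 := DD_pos (c := c) hp
  have hD := hasFDerivAt_DD c p
  have hi := (hasDerivAt_inv d1.ne').comp_hasFDerivAt p hD
  have h1 : HasFDerivAt (fun p : ℝ × ℝ => ρ ^ 2 * p.1) (ρ ^ 2 • ContinuousLinearMap.fst ℝ ℝ ℝ) p :=
    hasFDerivAt_fst.const_mul _
  have h2 : HasFDerivAt (fun p : ℝ × ℝ => ρ ^ 2 * (p.2 - c))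
      (ρ ^ 2 • ContinuousLinearMap.snd ℝ ℝ ℝ) p :=
    (hasFDerivAt_snd.sub_const c).const_mul _
  have k := (h1.mul hi).prodMk ((h2.mul hi).const_add c)
  unfold TTd
  rw [Matrix.toLin_finTwoProd_toContinuousLinearMap]
  have e : TT c ρ = fun p : ℝ × ℝ => (ρ ^ 2 * p.1 * (DD c p)⁻¹, c + ρ ^ 2 * (p.2 - c) * (DD c p)⁻¹) := by
    funext p; simp [TT, div_eq_mul_inv]
  rw [e]
  convert! k using 1
  ext <;> simp <;> field_simp <;> ring

lemma TT_image {c ρ : ℝ} (hρ : 0 < ρ) : TT c ρ '' HP = HP := by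
  apply Subset.antisymm
  · rintro _ ⟨p, hp, rfl⟩
    exact TT_mem hρ hp
  · intro p hp
    exact ⟨TT c ρ p, TT_mem hρ hp, TT_TT hρ (DD_pos hp)⟩

lemma TT_injOn {c ρ : ℝ} (hρ : 0 < ρ) : InjOn (TT c ρ) HP := by
  intro p hp q hq h
  rw [← TT_TT hρ (DD_pos (c := c) hp), h, TT_TT hρ (DD_pos hq)]

lemma TT_integral {c ρ : ℝ} (hρ : 0 < ρ) (h : ℝ × ℝ → ℝ) :
    ∫ p in HP, h p / p.1 ^ 2 = ∫ p in HP, h (TT c ρ p) / p.1 ^ 2 := by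
  conv_lhs => rw [← TT_image (c := c) hρ]
  rw [integral_image_eq_integral_abs_det_fderiv_smul volume measurableSet_HP
    (fun p hp => (hasFDerivAt_TT hp).hasFDerivWithinAt) (TT_injOn hρ)]
  refine setIntegral_congr_fun measurableSet_HP fun p hp => ?_
  have h2 : 0 < p.1 := hp
  have d1 := DD_pos (c := c) hp
  simp only [smul_eq_mul]
  rw [det_TTd hp, abs_neg, abs_of_nonneg (by positivity)]
  show _ * (_ / (ρ ^ 2 * p.1 / DD c p) ^ 2) = _
  field_simp

lemma continuousOn_TT {c ρ : ℝ} : ContinuousOn (TT c ρ) HP := fun _ hp =>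
  (hasFDerivAt_TT hp).continuousAt.continuousWithinAt

lemma WeakEq.comp_TT {a : ℝ} {y F : ℝ × ℝ → ℝ} (h : WeakEq a y F) (c : ℝ) {ρ : ℝ} (hρ : 0 < ρ) :
    WeakEq a (fun p => y (TT c ρ p)) (fun p => F (TT c ρ p)) := by
  intro q hq Θ hΘ
  have k := h (TT c ρ q) (TT_mem hρ hq) Θ hΘ
  have e1 := TT_integral (c := c) hρ (fun p => y p * AA a Θ (xx (TT c ρ q) p))
  have e2 := TT_integral (c := c) hρ (fun p => F p * Θ (xx (TT c ρ q) p))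
  simp only [← mul_div_assoc] at k ⊢
  rw [e1, e2] at k
  rw [setIntegral_congr_fun measurableSet_HP (g := fun p =>
      y (TT c ρ p) * AA a Θ (xx (TT c ρ q) (TT c ρ p)) / p.1 ^ 2), k]
  · refine setIntegral_congr_fun measurableSet_HP fun p hp => ?_
    simp only [xx_TT hρ hq hp]
  · intro p hp
    simp only [xx_TT hρ hq hp]

end Heisenberg

end

section

open scoped ContDiff

namespace Heisenberg

def chi (δ z : ℝ) : ℝ := smoothTransition (1 - z / δ)

def EE (ε z : ℝ) : ℝ := z ^ 2 + 2 * z + ε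

def Th (δ ε x : ℝ) : ℝ := ∫ z in x..δ, chi δ z / EE ε z

lemma contDiff_chi (δ : ℝ) : ContDiff ℝ ∞ (chi δ) := by
  unfold chi
  exact smoothTransition.contDiff.comp (by fun_prop)

lemma chi_nonneg (δ z : ℝ) : 0 ≤ chi δ z := smoothTransition.nonneg _

lemma chi_le_one (δ z : ℝ) : chi δ z ≤ 1 := smoothTransition.le_one _

lemma chi_zero {δ z : ℝ} (hδ : 0 < δ) (h : δ ≤ z) : chi δ z = 0 := by
  apply smoothTransition.zero_of_nonpos
  have : 1 ≤ z / δ := by rwa [le_div_iff₀ hδ, one_mul]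
  linarith

lemma chi_pos {δ z : ℝ} (hδ : 0 < δ) (h : z < δ) : 0 < chi δ z := by
  apply smoothTransition.pos_of_pos
  have : z / δ < 1 := by rwa [div_lt_iff₀ hδ, one_mul]
  linarith

lemma chi_deriv_nonpos {δ : ℝ} (hδ : 0 < δ) (z : ℝ) : deriv (chi δ) z ≤ 0 := by
  apply Antitone.deriv_nonpos
  intro x y h
  apply smoothTransition.monotone
  have : x / δ ≤ y / δ := by gcongr
  linarith

lemma EE_pos {ε z : ℝ} (h : z ∈ Ioi (-(ε / 2))) : 0 < EE ε z := by
  have : -(ε / 2) < z := h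
  unfold EE; nlinarith [sq_nonneg z]

lemma EE_pos' {ε z : ℝ} (hε : 0 < ε) (h : 0 ≤ z) : 0 < EE ε z := EE_pos (by
  show -(ε / 2) < z; linarith)

lemma contDiff_EE (ε : ℝ) : ContDiff ℝ ∞ (EE ε) := by unfold EE; fun_prop

lemma contDiffOn_quot (δ ε : ℝ) :
    ContDiffOn ℝ ∞ (fun z => chi δ z / EE ε z) (Ioi (-(ε / 2))) :=
  (contDiff_chi δ).contDiffOn.div (contDiff_EE ε).contDiffOn fun _ hz => (EE_pos hz).ne'

lemma Th_hasDerivAt {δ ε x : ℝ} (hδ : 0 < δ) (hε : 0 < ε) (hx : x ∈ Ioi (-(ε / 2))) :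
    HasDerivAt (Th δ ε) (-(chi δ x / EE ε x)) x := by
  have hc := (contDiffOn_quot δ ε).continuousOn
  apply intervalIntegral.integral_hasDerivAt_left
  · apply ContinuousOn.intervalIntegrable
    apply hc.mono
    exact ordConnected_Ioi.uIcc_subset hx (show -(ε / 2) < δ by linarith)
  · exact hc.stronglyMeasurableAtFilter isOpen_Ioi x hx
  · exact hc.continuousAt (isOpen_Ioi.mem_nhds hx)

lemma Th_zero {δ ε x : ℝ} (hδ : 0 < δ) (hx : δ ≤ x) : Th δ ε x = 0 := by
  unfold Th
  rw [intervalIntegral.integral_zero_ae]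
  refine Eventually.of_forall fun z hz => ?_
  rw [uIoc_of_ge hx] at hz
  rw [chi_zero hδ hz.1.le, zero_div]

lemma Th_deriv {δ ε x : ℝ} (hδ : 0 < δ) (hε : 0 < ε) (hx : x ∈ Ioi (-(ε / 2))) :
    deriv (Th δ ε) x = -(chi δ x / EE ε x) := (Th_hasDerivAt hδ hε hx).deriv

lemma Th_prof {δ ε : ℝ} (hδ : 0 < δ) (hε : 0 < ε) : Prof (Th δ ε) := by
  refine ⟨⟨ε / 2, by linarith, ?_⟩, ⟨δ, hδ, fun x hx => Th_zero hδ hx⟩⟩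
  rw [contDiffOn_infty_iff_deriv_of_isOpen isOpen_Ioi]
  refine ⟨fun x hx => (Th_hasDerivAt hδ hε hx).differentiableAt.differentiableWithinAt, ?_⟩
  exact (contDiffOn_quot δ ε).neg.congr fun x hx => Th_deriv hδ hε hx

def nn (δ ε x : ℝ) : ℝ := - deriv (chi δ) x * (x ^ 2 + 2 * x) / EE ε x
def mm (δ ε x : ℝ) : ℝ := chi δ x * (2 * x + 2) * ε / EE ε x ^ 2

lemma Th_AA {δ ε x : ℝ} (hδ : 0 < δ) (hε : 0 < ε) (hx : 0 ≤ x) (a : ℝ) :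
    AA a (Th δ ε) x = nn δ ε x - mm δ ε x + a * (1 - a) * Th δ ε x := by
  have hm : x ∈ Ioi (-(ε / 2)) := by show -(ε / 2) < x; linarith
  have e : deriv (Th δ ε) =ᶠ[𝓝 x] fun x => -(chi δ x / EE ε x) := by
    filter_upwards [isOpen_Ioi.mem_nhds hm] with z hz using Th_deriv hδ hε hz
  have hE := EE_pos hm
  have dE : HasDerivAt (EE ε) (2 * x + 2) x := by
    have := (((hasDerivAt_id x).pow 2).add ((hasDerivAt_id x).const_mul 2)).add_const ε
    convert! this using 1
    simp
  have dc : HasDerivAt (chi δ) (deriv (chi δ) x) x :=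
    ((contDiff_chi δ).differentiable (by simp) x).hasDerivAt
  unfold AA
  rw [e.deriv_eq, Th_deriv hδ hε hm, ((dc.fun_div dE hE.ne').fun_neg).deriv]
  unfold nn mm
  have h3 : x ^ 2 + 2 * x + ε = EE ε x := rfl
  field_simp
  generalize EE ε x = P at *
  linear_combination 2 * (1 + x) * chi δ x * h3

lemma nn_nonneg {δ ε x : ℝ} (hδ : 0 < δ) (hε : 0 < ε) (hx : 0 ≤ x) : 0 ≤ nn δ ε x := by
  have := chi_deriv_nonpos hδ x
  have h2 := EE_pos' hε hx
  unfold nn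
  have : 0 ≤ - deriv (chi δ) x := by linarith
  positivity

lemma nn_le {δ ε x : ℝ} (hδ : 0 < δ) (hε : 0 < ε) (hx : 0 ≤ x) : nn δ ε x ≤ - deriv (chi δ) x := by
  have := chi_deriv_nonpos hδ x
  have h2 := EE_pos' hε hx
  unfold nn
  have : 0 ≤ - deriv (chi δ) x := by linarith
  rw [div_le_iff₀ h2]
  unfold EE
  nlinarith

lemma mm_nonneg {δ ε x : ℝ} (hε : 0 < ε) (hx : 0 ≤ x) : 0 ≤ mm δ ε x := by
  have := chi_nonneg δ x
  have h2 := EE_pos' hε hx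
  unfold mm
  positivity

lemma mm_le {δ δ' ε x : ℝ} (hε : 0 < ε) (hδ' : 0 < δ') (hx : δ' ≤ x) :
    mm δ ε x ≤ ε * (chi δ x * (2 * x + 2) / δ' ^ 2) := by
  have := chi_nonneg δ x
  have hx0 : 0 ≤ x := by linarith
  have h2 : δ' ≤ EE ε x := by unfold EE; nlinarith [sq_nonneg x]
  unfold mm
  rw [show ε * (chi δ x * (2 * x + 2) / δ' ^ 2) = chi δ x * (2 * x + 2) * ε / δ' ^ 2 by ring]
  gcongr

lemma nn_zero {δ x : ℝ} (hδ : 0 < δ) (hx : δ + 1 ≤ x) : deriv (chi δ) x = 0 := by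
  have : chi δ =ᶠ[𝓝 x] fun _ => 0 := by
    filter_upwards [Ioi_mem_nhds (show δ < x by linarith)] with z hz
    exact chi_zero hδ (le_of_lt hz)
  rw [this.deriv_eq]; simp

lemma Th_anti {δ ε x : ℝ} (hδ : 0 < δ) (hε : 0 < ε) (hε1 : ε ≤ 1) (hx : 0 ≤ x) :
    Th δ 1 x ≤ Th δ ε x := by
  rcases le_total δ x with h | h
  · rw [Th_zero hδ h, Th_zero hδ h]
  · have ii : ∀ ε > 0, IntervalIntegrable (fun z => chi δ z / EE ε z) volume x δ := by
      intro ε hε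
      apply ContinuousOn.intervalIntegrable
      apply (contDiffOn_quot δ ε).continuousOn.mono
      rw [uIcc_of_le h]
      intro z hz
      show -(ε / 2) < z
      have := hz.1
      linarith
    apply intervalIntegral.integral_mono_on h (ii 1 one_pos) (ii ε hε)
    intro z hz
    have hz0 : 0 ≤ z := hx.trans hz.1
    have := chi_nonneg δ z
    have h2 := EE_pos' hε hz0
    gcongr
    unfold EE; linarith

lemma Th_nonneg {δ ε x : ℝ} (hδ : 0 < δ) (hε : 0 < ε) (hx : 0 ≤ x) :
    0 ≤ Th δ ε x := by
  rcases le_total δ x with h | h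
  · rw [Th_zero hδ h]
  · apply intervalIntegral.integral_nonneg h
    intro z hz
    have hz0 : 0 ≤ z := hx.trans hz.1
    have := chi_nonneg δ z
    have h2 := EE_pos' hε hz0
    positivity

lemma Th_pos {δ ε : ℝ} (hδ : 0 < δ) (hε : 0 < ε) : 0 < Th δ ε 0 := by
  apply intervalIntegral.intervalIntegral_pos_of_pos_on _ _ hδ
  · apply ContinuousOn.intervalIntegrable
    apply (contDiffOn_quot δ ε).continuousOn.mono
    rw [uIcc_of_le hδ.le]
    intro z hz
    show -(ε / 2) < z
    have := hz.1
    linarith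
  · intro z hz
    have := chi_pos hδ hz.2
    have h2 := EE_pos' hε hz.1.le
    positivity

lemma xx_small {q : ℝ × ℝ} (hq : q ∈ HP) {S : Set (ℝ × ℝ)} (hS : S ∈ 𝓝 q) :
    ∃ δ, 0 < δ ∧ δ ≤ 1 ∧ ∀ p ∈ HP, xx q p ≤ δ → p ∈ S := by
  obtain ⟨r, hr, hb⟩ := Metric.mem_nhds_iff.1 hS
  have h1 : 0 < q.1 := hq
  refine ⟨min 1 (r ^ 2 / (16 * q.1 ^ 2)), by positivity, min_le_left _ _, fun p hp hx => hb ?_⟩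
  have h2 : 0 < p.1 := hp
  have hx1 : xx q p ≤ 1 := hx.trans (min_le_left _ _)
  have hx2 : xx q p ≤ r ^ 2 / (16 * q.1 ^ 2) := hx.trans (min_le_right _ _)
  have h3 : p.1 ≤ 4 * q.1 := by
    have := (mem_box hq hp zero_le_one hx1).1.2
    linarith
  have h4 : (p.1 - q.1) ^ 2 + (p.2 - q.2) ^ 2 = xx q p * (2 * p.1 * q.1) := by
    unfold xx; field_simp
  have h5 : (p.1 - q.1) ^ 2 + (p.2 - q.2) ^ 2 < r ^ 2 := by
    rw [h4]
    calc xx q p * (2 * p.1 * q.1) ≤ r ^ 2 / (16 * q.1 ^ 2) * (2 * (4 * q.1) * q.1) := by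
          gcongr
      _ = r ^ 2 / 2 := by field_simp; norm_num
      _ < r ^ 2 := by have := sq_pos_of_pos hr; linarith
  rw [Metric.mem_ball, Prod.dist_eq, max_lt_iff, Real.dist_eq, Real.dist_eq]
  constructor
  · apply abs_lt_of_sq_lt_sq _ hr.le
    nlinarith [sq_nonneg (p.2 - q.2)]
  · apply abs_lt_of_sq_lt_sq _ hr.le
    nlinarith [sq_nonneg (p.1 - q.1)]

lemma weakEq_one : WeakEq 0 (fun _ => 1) (fun _ => 0) := by
  have := WeakEq.barrier 0 (η := fun _ => 1) (η' := fun _ => 0) (η'' := fun _ => 0)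
    (fun s _ => hasDerivAt_const s 1) (fun s _ => hasDerivAt_const s 0) continuousOn_const
  simpa using this

lemma Th_int_pos {q : ℝ × ℝ} (hq : q ∈ HP) {δ : ℝ} (hδ : 0 < δ) :
    0 < ∫ p in HP, Th δ 1 (xx q p) / p.1 ^ 2 := by
  have hP := Th_prof hδ one_pos
  rw [to_univ (G := tst (-2) q (Th δ 1))]
  · refine Continuous.integral_pos_of_hasCompactSupport_nonneg_nonzero (x := q)
      (contDiff_tst hq hP).continuous (hasCompactSupport_tst hq hP) ?_ ?_
    · intro p
      show 0 ≤ tst _ _ _ p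
      unfold tst
      split_ifs with h
      · have := Th_nonneg hδ one_pos (xx_nonneg hq (show p ∈ HP from h))
        positivity
      · exact le_rfl
    · rw [tst_eq hq]
      have h1 : 0 < q.1 := hq
      have := Th_pos hδ one_pos
      have e : xx q q = 0 := by simp [xx]
      rw [e]; positivity
  · intro p hp
    have h1 : 0 < p.1 := hp
    rw [tst_eq hp, rpow_neg h1.le, div_eq_inv_mul]; norm_cast
  · intro p hp
    exact if_neg hp

/-- Maximum principle at an interior maximum. -/
lemma MP {a : ℝ} {y F : ℝ × ℝ → ℝ} (h : WeakEq a y F) (cy : ContinuousOn y HP)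
    (cF : ContinuousOn F HP) {q : ℝ × ℝ} (hq : q ∈ HP) (hy : ∀ᶠ p in 𝓝 q, y p ≤ 0)
    (hy0 : y q = 0) : F q ≤ 0 := by
  by_contra hF
  push Not at hF
  set b := a * (1 - a) with hb
  have cyq := cy.continuousAt (isOpen_HP.mem_nhds hq)
  have cFq := cF.continuousAt (isOpen_HP.mem_nhds hq)
  have ev1 : ∀ᶠ p in 𝓝 q, F q / 2 < F p - b * y p := by
    have : Tendsto (fun p => F p - b * y p) (𝓝 q) (𝓝 (F q - b * y q)) :=
      cFq.tendsto.sub (cyq.tendsto.const_mul b)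
    apply this.eventually_const_lt
    rw [hy0]; linarith
  have evs : ∀ κ > 0, ∀ᶠ p in 𝓝 q, -κ < y p := by
    intro κ hκ
    apply cyq.eventually_const_lt
    rw [hy0]; linarith
  obtain ⟨δ, hδ, hδ1, hS⟩ := xx_small hq (hy.and (ev1.and (evs 1 one_pos)))
  have hc1 : ContinuousOn (fun _ : ℝ × ℝ => (1 : ℝ)) HP := continuousOn_const
  set K := ∫ p in HP, (1 : ℝ) * (- deriv (chi δ) (xx q p) / p.1 ^ 2) with hK
  set K2 := ∫ p in HP, (1 : ℝ) * (chi δ (xx q p) * (2 * xx q p + 2) / p.1 ^ 2) with hK2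
  set K1 := ∫ p in HP, Th δ 1 (xx q p) / p.1 ^ 2 with hK1
  have K1pos : 0 < K1 := Th_int_pos hq hδ
  have cchi : Continuous (chi δ) := (contDiff_chi δ).continuous
  have cchi' : Continuous (deriv (chi δ)) := (contDiff_chi δ).continuous_deriv (by simp)
  have iK : IntegrableOn (fun p => (1 : ℝ) * (- deriv (chi δ) (xx q p) / p.1 ^ 2)) HP :=
    integrableOn_HP (h := fun x => - deriv (chi δ) x) hq hc1 cchi'.neg.continuousOn
      (by linarith : 0 ≤ δ + 1) (fun x hx => by rw [nn_zero hδ hx, neg_zero])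
  have iK2 : IntegrableOn (fun p => (1 : ℝ) * (chi δ (xx q p) * (2 * xx q p + 2) / p.1 ^ 2)) HP :=
    integrableOn_HP (h := fun x => chi δ x * (2 * x + 2)) hq hc1 (by fun_prop) hδ.le
      (fun x hx => by rw [chi_zero hδ hx, zero_mul])
  have hEc : ∀ ε, Continuous (EE ε) := fun ε => (contDiff_EE ε).continuous
  have in' : ∀ ε > 0, ∀ {z : ℝ × ℝ → ℝ}, ContinuousOn z HP →
      IntegrableOn (fun p => z p * (nn δ ε (xx q p) / p.1 ^ 2)) HP := by
    intro ε hε z hz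
    refine integrableOn_HP (h := nn δ ε) hq hz ?_ (by linarith : 0 ≤ δ + 1) (fun x hx => ?_)
    · unfold nn
      refine ContinuousOn.div (by fun_prop) (hEc ε).continuousOn fun x hx => (EE_pos' hε hx).ne'
    · rw [nn, nn_zero hδ hx]; simp
  have im : ∀ ε > 0, ∀ {z : ℝ × ℝ → ℝ}, ContinuousOn z HP →
      IntegrableOn (fun p => z p * (mm δ ε (xx q p) / p.1 ^ 2)) HP := by
    intro ε hε z hz
    have := hEc ε
    refine integrableOn_HP (h := mm δ ε) hq hz ?_ hδ.le (fun x hx => ?_)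
    · unfold mm
      refine ContinuousOn.div (by fun_prop) (by fun_prop) fun x hx => ?_
      exact pow_ne_zero 2 (EE_pos' hε hx).ne'
    · rw [mm, chi_zero hδ hx]; simp
  -- mass bound
  have mass : ∀ ε > 0, ∫ p in HP, (1 : ℝ) * (mm δ ε (xx q p) / p.1 ^ 2) ≤ K := by
    intro ε hε
    have e := weakEq_one q hq _ (Th_prof hδ hε)
    simp only [zero_mul, integral_zero] at e
    have e2 : ∫ p in HP, (1 : ℝ) * (AA 0 (Th δ ε) (xx q p) / p.1 ^ 2) =
        ∫ p in HP, ((1 : ℝ) * (nn δ ε (xx q p) / p.1 ^ 2) -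
          (1 : ℝ) * (mm δ ε (xx q p) / p.1 ^ 2)) := by
      refine setIntegral_congr_fun measurableSet_HP fun p hp => ?_
      rw [Th_AA hδ hε (xx_nonneg hq hp)]; ring
    rw [e2, integral_sub (in' ε hε hc1) (im ε hε hc1)] at e
    have e3 : ∫ p in HP, (1 : ℝ) * (nn δ ε (xx q p) / p.1 ^ 2) ≤ K := by
      refine setIntegral_mono_on (in' ε hε hc1) iK measurableSet_HP fun p hp => ?_
      have := nn_le hδ hε (xx_nonneg hq hp)
      gcongr
    linarith
  have Kn : 0 ≤ K := by
    refine le_trans ?_ (mass 1 one_pos)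
    refine setIntegral_nonneg measurableSet_HP fun p hp => ?_
    have := mm_nonneg (δ := δ) one_pos (xx_nonneg hq hp)
    positivity
  -- main estimate
  set κ := F q / 2 * K1 / (2 * (K + 1)) with hκ
  have κpos : 0 < κ := by positivity
  obtain ⟨δ', hδ', -, hS'⟩ := xx_small hq (evs κ κpos)
  have est : ∀ ε, 0 < ε → ε ≤ 1 → F q / 2 * K1 ≤ κ * K + ε * (K2 / δ' ^ 2) := by
    intro ε hε hε1
    have w := h q hq _ (Th_prof hδ hε)
    have cb : ContinuousOn (fun p => F p - b * y p) HP := cF.sub (cy.const_smul b)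
    have w2 : ∫ p in HP, (F p - b * y p) * (Th δ ε (xx q p) / p.1 ^ 2) =
        ∫ p in HP, (y p * (nn δ ε (xx q p) / p.1 ^ 2) - y p * (mm δ ε (xx q p) / p.1 ^ 2)) := by
      have i1 := (Th_prof hδ hε).int_self hq cF
      have i2 := (Th_prof hδ hε).int_AA (a := a) hq cy
      have i3 : IntegrableOn (fun p => b * y p * (Th δ ε (xx q p) / p.1 ^ 2)) HP :=
        (Th_prof hδ hε).int_self hq (cy.const_smul b)
      have e1 := integral_sub i1 i3
      have e2 := integral_sub i2 i3
      rw [w, ← e1] at e2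
      rw [setIntegral_congr_fun measurableSet_HP (g := fun p =>
        F p * (Th δ ε (xx q p) / p.1 ^ 2) - b * y p * (Th δ ε (xx q p) / p.1 ^ 2)), ← e2]
      · refine setIntegral_congr_fun measurableSet_HP fun p hp => ?_
        rw [Th_AA hδ hε (xx_nonneg hq hp)]; ring
      · intro p hp
        simp only; ring
    have lo : F q / 2 * K1 ≤ ∫ p in HP, (F p - b * y p) * (Th δ ε (xx q p) / p.1 ^ 2) := by
      rw [hK1, ← integral_const_mul]
      refine setIntegral_mono_on ?_ ((Th_prof hδ hε).int_self hq cb) measurableSet_HP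
        fun p hp => ?_
      · exact (Th_prof hδ one_pos).int_self hq continuousOn_const
      · have h0 := xx_nonneg hq hp
        have h1 := Th_anti hδ hε hε1 h0
        have h2 := Th_nonneg hδ one_pos h0
        rcases le_total (xx q p) δ with hx | hx
        · have h5 : F q / 2 < F p - b * y p := (hS p hp hx).2.1
          have h6 : 0 ≤ F p - b * y p := by linarith
          gcongr
        · rw [Th_zero hδ hx, Th_zero hδ hx]; simp
    have hi : ∫ p in HP, (y p * (nn δ ε (xx q p) / p.1 ^ 2) - y p * (mm δ ε (xx q p) / p.1 ^ 2)) ≤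
        ∫ p in HP, (κ * ((1 : ℝ) * (mm δ ε (xx q p) / p.1 ^ 2)) +
          ε / δ' ^ 2 * ((1 : ℝ) * (chi δ (xx q p) * (2 * xx q p + 2) / p.1 ^ 2))) := by
      refine setIntegral_mono_on ((in' ε hε cy).sub (im ε hε cy)) 
        (((im ε hε hc1).const_mul κ).add (iK2.const_mul _)) measurableSet_HP fun p hp => ?_
      have h0 := xx_nonneg hq hp
      have hm := mm_nonneg (δ := δ) hε h0
      have hn := nn_nonneg hδ hε h0
      have hch := chi_nonneg δ (xx q p)
      have hp1 : 0 < p.1 := hp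
      have key : y p * nn δ ε (xx q p) - y p * mm δ ε (xx q p) ≤ κ * mm δ ε (xx q p) +
          ε / δ' ^ 2 * (chi δ (xx q p) * (2 * xx q p + 2)) := by
        rcases le_total (xx q p) δ with hx | hx
        · have h3 := (hS p hp hx)
          have hyp : y p ≤ 0 := h3.1
          have h4 : y p * nn δ ε (xx q p) ≤ 0 := mul_nonpos_of_nonpos_of_nonneg hyp hn
          rcases le_total (xx q p) δ' with hx' | hx'
          · have : -κ < y p := hS' p hp hx'
            have : 0 ≤ ε / δ' ^ 2 * (chi δ (xx q p) * (2 * xx q p + 2)) := by positivity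
            nlinarith
          · have := mm_le (δ := δ) hε hδ' hx'
            have e : ε / δ' ^ 2 * (chi δ (xx q p) * (2 * xx q p + 2)) =
              ε * (chi δ (xx q p) * (2 * xx q p + 2) / δ' ^ 2) := by ring
            rw [e]
            have : -1 < y p := h3.2.2
            nlinarith
        · have e1 : chi δ (xx q p) = 0 := chi_zero hδ hx
          have e2 : deriv (chi δ) (xx q p) = 0 := by
            have : IsLocalMin (chi δ) (xx q p) := by
              refine Eventually.of_forall fun z => ?_
              rw [e1]; exact chi_nonneg δ z
            exact this.deriv_eq_zero
          simp [nn, mm, e1, e2]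
      have : (y p * nn δ ε (xx q p) - y p * mm δ ε (xx q p)) / p.1 ^ 2 ≤ (κ * mm δ ε (xx q p) +
          ε / δ' ^ 2 * (chi δ (xx q p) * (2 * xx q p + 2))) / p.1 ^ 2 := by gcongr
      calc _ = (y p * nn δ ε (xx q p) - y p * mm δ ε (xx q p)) / p.1 ^ 2 := by ring
        _ ≤ _ := this
        _ = _ := by ring
    rw [integral_add ((im ε hε hc1).const_mul κ) (iK2.const_mul _),
      integral_const_mul κ, integral_const_mul (ε / δ' ^ 2), ← w2] at hi
    have := mass ε hε
    calc F q / 2 * K1 ≤ _ := lo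
      _ ≤ _ := hi
      _ ≤ κ * K + ε / δ' ^ 2 * K2 := by gcongr
      _ = _ := by ring
  have lim : Tendsto (fun ε : ℝ => κ * K + ε * (K2 / δ' ^ 2)) (𝓝[>] 0) (𝓝 (κ * K + 0 * (K2 / δ' ^ 2))) := by
    apply tendsto_nhdsWithin_of_tendsto_nhds
    apply Continuous.tendsto
    fun_prop
  have fin : F q / 2 * K1 ≤ κ * K + 0 * (K2 / δ' ^ 2) := by
    apply ge_of_tendsto lim
    filter_upwards [Ioc_mem_nhdsGT (zero_lt_one (α := ℝ))] with ε hε using est ε hε.1 hε.2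
  have : κ * K ≤ F q / 2 * K1 / 2 := by
    rw [hκ, div_mul_eq_mul_div, div_le_div_iff₀ (by positivity) (by positivity)]
    have : 0 < F q / 2 * K1 := by positivity
    nlinarith
  have : 0 < F q / 2 * K1 := by positivity
  linarith

end Heisenberg

end

section

open scoped ContDiff

namespace Heisenberg

lemma WeakEq.congr {a : ℝ} {y F y' F' : ℝ × ℝ → ℝ} (h : WeakEq a y F)
    (h1 : ∀ p ∈ HP, y p = y' p) (h2 : ∀ p ∈ HP, F p = F' p) : WeakEq a y' F' := by
  intro q hq Θ hΘ
  have e1 : ∫ p in HP, y' p * (AA a Θ (xx q p) / p.1 ^ 2) =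
      ∫ p in HP, y p * (AA a Θ (xx q p) / p.1 ^ 2) :=
    setIntegral_congr_fun measurableSet_HP fun p hp => by simp only [h1 p hp]
  have e2 : ∫ p in HP, F' p * (Θ (xx q p) / p.1 ^ 2) =
      ∫ p in HP, F p * (Θ (xx q p) / p.1 ^ 2) :=
    setIntegral_congr_fun measurableSet_HP fun p hp => by simp only [h2 p hp]
  rw [e1, e2, h q hq Θ hΘ]

lemma barrier_pow (a : ℝ) {b b' b'' : ℝ → ℝ} (h : ∀ s, 0 < s → HasDerivAt b (b' s) s)
    (h' : ∀ s, 0 < s → HasDerivAt b' (b'' s) s) (hc : ContinuousOn b'' (Ioi 0)) :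
    WeakEq a (fun p => p.1 ^ a * b p.1)
      (fun p => p.1 ^ (a + 1) * (p.1 * b'' p.1 + 2 * a * b' p.1)) := by
  have r : ∀ (α s : ℝ), 0 < s → HasDerivAt (fun s : ℝ => s ^ α) (α * s ^ (α - 1)) s :=
    fun α s hs => hasDerivAt_rpow_const (Or.inl hs.ne')
  have cb : ContinuousOn b (Ioi 0) := fun s hs => (h s hs).continuousAt.continuousWithinAt
  have cb' : ContinuousOn b' (Ioi 0) := fun s hs => (h' s hs).continuousAt.continuousWithinAt
  have cr : ∀ α : ℝ, ContinuousOn (fun s : ℝ => s ^ α) (Ioi 0) := fun α s hs =>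
    (r α s hs).continuousAt.continuousWithinAt
  have := WeakEq.barrier a (η := fun s => s ^ a * b s)
    (η' := fun s => a * s ^ (a - 1) * b s + s ^ a * b' s)
    (η'' := fun s => (a * ((a - 1) * s ^ (a - 1 - 1))) * b s + (a * s ^ (a - 1)) * b' s +
      (a * s ^ (a - 1) * b' s + s ^ a * b'' s))
    (fun s hs => (r a s hs).fun_mul (h s hs))
    (fun s hs => (((r (a - 1) s hs).const_mul a).fun_mul (h s hs)).fun_add
      ((r a s hs).fun_mul (h' s hs)))
    (by
      have := cr a
      have := cr (a - 1)
      have := cr (a - 1 - 1)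
      fun_prop)
  refine this.congr (fun p hp => rfl) (fun p hp => ?_)
  have hp1 : 0 < p.1 := hp
  have e1 : p.1 ^ a = p.1 ^ (a - 1 - 1) * p.1 ^ 2 := by
    rw [← rpow_natCast, ← rpow_add hp1]; congr 1; push_cast; ring
  have e2 : p.1 ^ (a + 1) = p.1 ^ (a - 1 - 1) * p.1 ^ 3 := by
    rw [← rpow_natCast, ← rpow_add hp1]; congr 1; push_cast; ring
  have e3 : p.1 ^ (a - 1) = p.1 ^ (a - 1 - 1) * p.1 := by
    conv_rhs => rw [← rpow_add_one hp1.ne']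
    congr 1; ring
  rw [e1, e2, e3]; ring

/-- weak maximum principle. -/
lemma WMP {n : ℕ} (hn : 1 ≤ n) {U F : ℝ × ℝ → ℝ}
    (h : WeakEq ((n : ℝ) / 2) (fun p => p.1 ^ ((n : ℝ) / 2) * U p) F)
    (cU : ContinuousOn U HP) (cF : ContinuousOn F HP) {Ω : Set (ℝ × ℝ)} (Ωo : IsOpen Ω)
    (Ωs : Ω ⊆ HP) (bdd : Bornology.IsBounded Ω) {ρ B m A : ℝ} (hρ : 0 < ρ)
    (hΩρ : ∀ p ∈ Ω, p.1 ≤ ρ) (hB : ∀ p ∈ Ω, U p ≤ B)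
    (hm : ∀ p ∈ closure Ω, p ∉ Ω → p ∈ HP → U p ≤ m) (hA : 0 ≤ A)
    (hF : ∀ p ∈ Ω, -A * p.1 ^ ((n : ℝ) / 2 + 1) ≤ F p) :
    ∀ p ∈ Ω, U p ≤ m + A * ρ / n := by
  intro X0 hX0
  have hn' : (1 : ℝ) ≤ n := by exact_mod_cast hn
  have hn0 : (0 : ℝ) < n := by linarith
  suffices H : ∀ ε : ℝ, 0 < ε → U X0 ≤ m + (A + ε) * ρ / n + ε * (log ρ - log X0.1) by
    have lim : Tendsto (fun ε : ℝ => m + (A + ε) * ρ / n + ε * (log ρ - log X0.1)) (𝓝[>] 0)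
        (𝓝 (m + (A + 0) * ρ / n + 0 * (log ρ - log X0.1))) := by
      apply tendsto_nhdsWithin_of_tendsto_nhds
      apply Continuous.tendsto (f := fun ε : ℝ => m + (A + ε) * ρ / n + ε * (log ρ - log X0.1))
      fun_prop
    have := ge_of_tendsto lim (by
      filter_upwards [self_mem_nhdsWithin] with ε hε using H ε hε)
    simpa using this
  intro ε hε
  by_contra hc
  push Not at hc
  set β := (A + ε) / n with hβ
  have hβ0 : 0 < β := by positivity
  have hc' : m + β * ρ + ε * (log ρ - log X0.1) < U X0 := by
    have : (A + ε) * ρ / n = β * ρ := by rw [hβ]; ring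
    rwa [this] at hc
  set Z : ℝ × ℝ → ℝ := fun p => U p - m - β * (ρ - p.1) - ε * (log ρ - log p.1) with hZ
  have clog : ContinuousOn (fun p : ℝ × ℝ => log p.1) HP := by
    refine ContinuousOn.log continuousOn_fst fun p hp => ?_
    exact ne_of_gt hp
  have cZ : ContinuousOn Z HP := by
    rw [hZ]; fun_prop
  have hX0' : 0 < X0.1 := Ωs hX0
  have Z0 : 0 < Z X0 := by
    simp only [hZ]; nlinarith
  set s1 := ρ * exp (-|B - m| / ε) with hs1
  have s1pos : 0 < s1 := by positivity
  have small : ∀ p ∈ Ω, p.1 < s1 → Z p ≤ 0 := by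
    intro p hp hps
    have hp0 : 0 < p.1 := Ωs hp
    have h1 := hB p hp
    have h2 := hΩρ p hp
    have h3 : log p.1 ≤ log ρ + -|B - m| / ε := by
      have := log_le_log hp0 hps.le
      rwa [hs1, log_mul hρ.ne' (exp_pos _).ne', log_exp] at this
    have h4 : ε * (|B - m| / ε) ≤ ε * (log ρ - log p.1) := by
      gcongr
      rw [neg_div] at h3; linarith
    rw [mul_div_cancel₀ _ hε.ne'] at h4
    have h5 := le_abs_self (B - m)
    simp only [hZ]
    nlinarith
  set K := closure Ω ∩ {p | s1 ≤ p.1} with hK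
  have Kc : IsCompact K := by
    apply bdd.isCompact_closure.inter_right
    exact isClosed_le continuous_const continuous_fst
  have KH : K ⊆ HP := fun p hp => lt_of_lt_of_le s1pos hp.2
  have X0K : X0 ∈ K := by
    refine ⟨subset_closure hX0, ?_⟩
    by_contra h0
    exact absurd (small X0 hX0 (not_le.1 h0)) (not_le.2 Z0)
  obtain ⟨X1, hX1, hmax⟩ := Kc.exists_isMaxOn ⟨X0, X0K⟩ (cZ.mono KH)
  have Z1 : 0 < Z X1 := lt_of_lt_of_le Z0 (hmax X0K)
  have clρ : X1.1 ≤ ρ := by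
    have : closure Ω ⊆ {p | p.1 ≤ ρ} :=
      closure_minimal hΩρ (isClosed_le continuous_fst continuous_const)
    exact this hX1.1
  have X1H : X1 ∈ HP := KH hX1
  have X1p : 0 < X1.1 := X1H
  have X1Ω : X1 ∈ Ω := by
    by_contra h0
    have h1 := hm X1 hX1.1 h0 X1H
    have h2 := log_le_log X1p clρ
    have : Z X1 ≤ 0 := by simp only [hZ]; nlinarith
    linarith
  have loc : ∀ p ∈ Ω, Z p ≤ Z X1 := by
    intro p hp
    rcases lt_or_ge p.1 s1 with h1 | h1
    · exact (small p hp h1).trans Z1.le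
    · exact hmax ⟨subset_closure hp, h1⟩
  set a := (n : ℝ) / 2 with ha
  set b : ℝ → ℝ := fun s => m + Z X1 + β * (ρ - s) + ε * (log ρ - log s) with hb
  have bar := barrier_pow a (b := b) (b' := fun s => -β - ε * s⁻¹) (b'' := fun s => ε * (s ^ 2)⁻¹)
    (fun s hs => by
      have h1 := ((hasDerivAt_id s).const_sub ρ).const_mul β
      have h2 := ((hasDerivAt_log hs.ne').const_sub (log ρ)).const_mul ε
      have := (h1.const_add (m + Z X1)).add h2
      convert! this using 1
      ring)
    (fun s hs => by
      have h2 := ((hasDerivAt_inv hs.ne').const_mul ε).const_sub (-β)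
      convert! h2 using 1
      ring)
    (by
      refine ContinuousOn.mul continuousOn_const (ContinuousOn.inv₀ (by fun_prop) ?_)
      intro s hs
      have : 0 < s := hs
      positivity)
  have cr : ∀ α : ℝ, ContinuousOn (fun p : ℝ × ℝ => p.1 ^ α) HP := fun α =>
    continuousOn_fst.rpow_const fun p hp => Or.inl (ne_of_gt hp)
  have cr1 := cr a
  have cr2 := cr (a + 1)
  have cb : ContinuousOn (fun p : ℝ × ℝ => b p.1) HP := by
    simp only [hb]; fun_prop
  have cinv : ContinuousOn (fun p : ℝ × ℝ => p.1⁻¹) HP :=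
    continuousOn_fst.inv₀ fun p hp => ne_of_gt hp
  have cinv2 : ContinuousOn (fun p : ℝ × ℝ => (p.1 ^ 2)⁻¹) HP :=
    (continuousOn_fst.pow 2).inv₀ fun p hp => pow_ne_zero 2 (ne_of_gt hp)
  have c1 : ContinuousOn (fun p : ℝ × ℝ => p.1 ^ a * U p) HP := by fun_prop
  have c2 : ContinuousOn (fun p : ℝ × ℝ => p.1 ^ a * b p.1) HP := cr1.mul cb
  have c3 : ContinuousOn (fun p : ℝ × ℝ => p.1 ^ (a + 1) *
      (p.1 * (ε * (p.1 ^ 2)⁻¹) + 2 * a * (-β - ε * p.1⁻¹))) HP := by fun_prop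
  have fin := MP (h.sub bar c1 c2 cF c3) (c1.sub c2) (cF.sub c3) X1H ?_ ?_
  · have h1 := hF X1 X1Ω
    have e : X1.1 * (ε * (X1.1 ^ 2)⁻¹) + 2 * a * (-β - ε * X1.1⁻¹) =
        - A - ε - (n - 1) * ε * X1.1⁻¹ := by
      rw [ha, hβ]; field_simp; ring
    rw [e] at fin
    have h2 : 0 < X1.1 ^ (a + 1) := by positivity
    have h3 : 0 ≤ (n - 1) * ε * X1.1⁻¹ := by
      have : 0 ≤ (n : ℝ) - 1 := by linarith
      positivity
    nlinarith [mul_pos h2 hε, mul_nonneg h2.le h3]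
  · filter_upwards [Ωo.mem_nhds X1Ω] with p hp
    have h1 := loc p hp
    have h2 : 0 < p.1 := Ωs hp
    have h3 : 0 < p.1 ^ a := by positivity
    have : U p - b p.1 ≤ 0 := by
      simp only [hZ, hb] at h1 ⊢; linarith
    nlinarith
  · have : U X1 - b X1.1 = 0 := by
      simp only [hZ, hb]; ring
    linear_combination X1.1 ^ a * this

end Heisenberg

end

section

open scoped ContDiff

namespace Heisenberg

lemma cont_rpow_HP (α : ℝ) : ContinuousOn (fun p : ℝ × ℝ => p.1 ^ α) HP :=
  continuousOn_fst.rpow_const fun _ hp => Or.inl (ne_of_gt hp)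

lemma isCompact_DD (c R : ℝ) : IsCompact {p : ℝ × ℝ | DD c p ≤ R} := by
  have hc : IsClosed {p : ℝ × ℝ | DD c p ≤ R} := isClosed_le (continuous_DD c) continuous_const
  refine (Metric.isBounded_iff_subset_closedBall (0, c)).2 ⟨R + 1, ?_⟩ |>.isCompact_closure
    |>.of_isClosed_subset hc subset_closure
  intro p hp
  have hp' : p.1 ^ 2 + (p.2 - c) ^ 2 ≤ R := hp
  have hR : 0 ≤ R := (DD_nonneg c p).trans hp
  rw [Metric.mem_closedBall, Prod.dist_eq, max_le_iff, Real.dist_eq, Real.dist_eq, sub_zero]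
  constructor
  · apply abs_le_of_sq_le_sq _ (by linarith); nlinarith [sq_nonneg (p.2 - c)]
  · apply abs_le_of_sq_le_sq _ (by linarith); nlinarith [sq_nonneg p.1]

lemma TT_fst {c ρ : ℝ} (p : ℝ × ℝ) : (TT c ρ p).1 = p.1 * (ρ ^ 2 / DD c p) := by
  simp only [TT]; ring

lemma TT_fst_rpow {c ρ : ℝ} {p : ℝ × ℝ} (hp : p ∈ HP) (α : ℝ) :
    (TT c ρ p).1 ^ α = p.1 ^ α * (ρ ^ 2 / DD c p) ^ α := by
  have h0 : 0 < p.1 := hp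
  have := DD_pos (c := c) hp
  rw [TT_fst, mul_rpow h0.le (by positivity)]

lemma TT_fix {c ρ : ℝ} (hρ : 0 < ρ) {p : ℝ × ℝ} (h : DD c p = ρ ^ 2) : TT c ρ p = p := by
  simp only [TT, h]
  ext
  · simp; field_simp
  · simp; field_simp; ring

/-- difference of a function and its Kelvin transform. -/
def UU (a c ρ : ℝ) (w : ℝ × ℝ → ℝ) (p : ℝ × ℝ) : ℝ :=
  w p - (ρ ^ 2 / DD c p) ^ a * w (TT c ρ p)

lemma cont_k (a c : ℝ) {ρ : ℝ} (hρ : 0 < ρ) :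
    ContinuousOn (fun p : ℝ × ℝ => (ρ ^ 2 / DD c p) ^ a) HP := by
  refine ContinuousOn.rpow_const ?_ ?_
  · exact continuousOn_const.div (continuous_DD c).continuousOn fun p hp => (DD_pos hp).ne'
  · intro p hp
    have := DD_pos (c := c) hp
    exact Or.inl (by positivity)

lemma cont_UU (a c : ℝ) {ρ : ℝ} (hρ : 0 < ρ) {w : ℝ × ℝ → ℝ} (hw : Continuous w) :
    ContinuousOn (UU a c ρ w) HP :=
  hw.continuousOn.sub ((cont_k a c hρ).mul (hw.comp_continuousOn continuousOn_TT))

/-- positive solutions decay at most like the fundamental solution. -/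
lemma lower {n : ℕ} (hn : 1 ≤ n) {w F : ℝ × ℝ → ℝ} (hw : Continuous w) (pos : ∀ p, 0 < w p)
    (h : WeakEq ((n : ℝ) / 2) (fun p => p.1 ^ ((n : ℝ) / 2) * w p) F) (cF : ContinuousOn F HP)
    (Fneg : ∀ p ∈ HP, F p ≤ 0) :
    ∃ δ > 0, ∀ p ∈ HP, 1 ≤ DD 0 p → δ ≤ DD 0 p ^ ((n : ℝ) / 2) * w p := by
  set a := (n : ℝ) / 2 with ha
  obtain ⟨p0, hp0, hmin⟩ := (isCompact_DD 0 1).exists_isMinOn ⟨(0, 0), by simp [DD]⟩ hw.continuousOn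
  refine ⟨w p0, pos p0, ?_⟩
  set U : ℝ × ℝ → ℝ := fun p => -((1 ^ 2 / DD 0 p) ^ a * w (TT 0 1 p)) with hU
  have hW : WeakEq a (fun p => p.1 ^ a * U p) (fun p => - F (TT 0 1 p)) := by
    refine (h.comp_TT 0 one_pos).neg.congr (fun p hp => ?_) (fun p hp => rfl)
    rw [TT_fst_rpow hp]; simp only [hU]; ring
  have cU : ContinuousOn U HP :=
    ((cont_k a 0 one_pos).mul (hw.comp_continuousOn continuousOn_TT)).neg
  have cF' : ContinuousOn (fun p => - F (TT 0 1 p)) HP :=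
    (cF.comp continuousOn_TT fun p hp => TT_mem one_pos hp).neg
  have Ωo : IsOpen (HP ∩ {p | DD 0 p < 1}) :=
    isOpen_HP.inter (isOpen_lt (continuous_DD 0) continuous_const)
  have key := WMP hn hW cU cF' (Ω := HP ∩ {p | DD 0 p < 1}) (ρ := 1) (B := 0) (m := -w p0) (A := 0)
    Ωo inter_subset_left ?_ one_pos ?_ ?_ ?_ le_rfl ?_
  · intro p hp h1
    rcases h1.eq_or_lt with h1 | h1
    · rw [← h1, one_rpow, one_mul]
      exact hmin (show DD 0 p ≤ 1 from h1.symm.le)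
    · have hq := TT_mem (c := 0) one_pos hp
      have hD := DD_pos (c := 0) hp
      have e := DD_TT (ρ := 1) hD
      have := key (TT 0 1 p) ⟨hq, by
        show DD 0 (TT 0 1 p) < 1
        rw [e, div_lt_one hD]; simpa using h1⟩
      simp only [hU, TT_TT one_pos hD, e] at this
      simp at this
      linarith
  · exact (isCompact_DD 0 1).isBounded.subset fun p hp => show DD 0 p ≤ 1 from le_of_lt hp.2
  · intro p hp
    have h2 : DD 0 p < 1 := hp.2
    unfold DD at h2
    nlinarith [sq_nonneg (p.2 - 0)]
  · intro p hp
    have := DD_pos (c := 0) hp.1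
    have := pos (TT 0 1 p)
    simp only [hU]
    have : 0 ≤ (1 ^ 2 / DD 0 p) ^ a * w (TT 0 1 p) := by positivity
    linarith
  · intro p hpc hpn hpH
    have h1 : DD 0 p ≤ 1 := by
      have : closure (HP ∩ {p | DD 0 p < 1}) ⊆ {p | DD 0 p ≤ 1} :=
        closure_minimal (fun p hp => show DD 0 p ≤ 1 from le_of_lt hp.2)
          (isClosed_le (continuous_DD 0) continuous_const)
      exact this hpc
    have h2 : 1 ≤ DD 0 p := by
      by_contra hc
      exact hpn ⟨hpH, not_le.1 hc⟩
    have h3 : DD 0 p = 1 := le_antisymm h1 h2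
    simp only [hU]
    rw [TT_fix one_pos (by rw [h3]; norm_num), h3]
    have := hmin (show DD 0 p ≤ 1 from h1)
    simp at this ⊢
    exact this
  · intro p hp
    have := Fneg _ (TT_mem (c := 0) one_pos hp.1)
    simp; linarith

/-- the structure conditions on the nonlinearities. -/
structure Nice (n : ℕ) (f : ℝ → ℝ) : Prop where
  cont : ContinuousOn f (Ici 0)
  mono : ∀ s t : ℝ, 0 < s → s ≤ t → f s ≤ f t
  anti : ∀ s t : ℝ, 0 < s → s ≤ t → f t / t ^ tau n ≤ f s / s ^ tau n

lemma tau_gt {n : ℕ} (hn : 1 ≤ n) : 1 < tau n := by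
  have hn' : (1 : ℝ) ≤ n := by exact_mod_cast hn
  unfold tau
  rw [lt_div_iff₀ (by linarith)]; linarith

lemma Nice.nonneg {n : ℕ} (hn : 1 ≤ n) {f : ℝ → ℝ} (h : Nice n f) {s : ℝ} (hs : 0 < s) :
    0 ≤ f s := by
  by_contra hc
  push Not at hc
  have h1 := h.mono (s / 2) s (by linarith) (by linarith)
  have h2 := h.anti (s / 2) s (by linarith) (by linarith)
  have hlt : (s / 2) ^ tau n < s ^ tau n :=
    rpow_lt_rpow (by linarith) (by linarith) (by have := tau_gt hn; linarith)
  have p1 : 0 < (s / 2) ^ tau n := by positivity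
  have p2 : 0 < s ^ tau n := by positivity
  rw [div_le_div_iff₀ p2 p1] at h2
  nlinarith

lemma Nice.key {n : ℕ} (hn : 1 ≤ n) {f : ℝ → ℝ} (h : Nice n f) {v v' k : ℝ} (hv : 0 < v)
    (hv' : 0 < v') (hk : 1 ≤ k) :
    f v - k ^ tau n * f v' ≤ tau n * f v / v * max (v - k * v') 0 := by
  have ht := tau_gt hn
  have f0 := h.nonneg hn hv
  have f0' := h.nonneg hn hv'
  rcases le_total v v' with hc | hc
  · have h1 := h.mono v v' hv hc
    have h2 : 1 ≤ k ^ tau n := one_le_rpow hk (by linarith)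
    have : 0 ≤ tau n * f v / v * max (v - k * v') 0 := by positivity
    nlinarith
  · have h1 := h.anti v' v hv' hc
    have p1 : 0 < v' ^ tau n := by positivity
    have p2 : 0 < v ^ tau n := by positivity
    rw [div_le_div_iff₀ p2 p1] at h1
    have e : (k * v' / v) ^ tau n = k ^ tau n * v' ^ tau n / v ^ tau n := by
      rw [div_rpow (by positivity) hv.le, mul_rpow (by positivity) hv'.le]
    have b := one_add_mul_self_le_rpow_one_add (s := k * v' / v - 1) (by
      have : 0 ≤ k * v' / v := by positivity
      linarith) ht.le
    rw [add_sub_cancel, e] at b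
    have h3 : f v * (k ^ tau n * v' ^ tau n / v ^ tau n) ≤ k ^ tau n * f v' := by
      rw [← mul_div_assoc, div_le_iff₀ p2]
      have : 0 < k ^ tau n := by positivity
      nlinarith
    have h4 : f v * (1 + tau n * (k * v' / v - 1)) ≤ k ^ tau n * f v' :=
      (mul_le_mul_of_nonneg_left b f0).trans h3
    have h5 : f v - f v * (1 + tau n * (k * v' / v - 1)) = tau n * f v / v * (v - k * v') := by
      field_simp; ring
    have h6 : tau n * f v / v * (v - k * v') ≤ tau n * f v / v * max (v - k * v') 0 := by
      gcongr
      exact le_max_left _ _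
    linarith

end Heisenberg

end

section

open scoped ContDiff

namespace Heisenberg

lemma k_tau {n : ℕ} (hn : 1 ≤ n) {x : ℝ} (hx : 0 ≤ x) :
    (x ^ ((n : ℝ) / 2)) ^ tau n = x ^ ((n : ℝ) / 2 + 1) := by
  have hn' : (1 : ℝ) ≤ n := by exact_mod_cast hn
  rw [← rpow_mul hx]
  congr 1
  unfold tau
  field_simp
  ring

lemma Nice.cont_comp {n : ℕ} {f : ℝ → ℝ} (h : Nice n f) {v : ℝ × ℝ → ℝ} (hv : Continuous v)
    (pos : ∀ p, 0 < v p) : Continuous (fun p => f (v p)) := by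
  rw [continuous_iff_continuousAt]
  intro p
  exact (h.cont.continuousAt (Ici_mem_nhds (pos p))).comp hv.continuousAt

lemma weakEq_UU {n : ℕ} {w v : ℝ × ℝ → ℝ} {f : ℝ → ℝ} (hf : Nice n f) (hn : 1 ≤ n)
    (hw : Continuous w) (hv : Continuous v) (vpos : ∀ p, 0 < v p) (c : ℝ) {ρ : ℝ} (hρ : 0 < ρ)
    (h : WeakEq ((n : ℝ) / 2) (fun p => p.1 ^ ((n : ℝ) / 2) * w p)
      (fun p => -(1 / 4) * p.1 ^ ((n : ℝ) / 2 + 1) * f (v p))) :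
    WeakEq ((n : ℝ) / 2) (fun p => p.1 ^ ((n : ℝ) / 2) * UU ((n : ℝ) / 2) c ρ w p)
      (fun p => -(1 / 4) * p.1 ^ ((n : ℝ) / 2 + 1) * (f (v p) -
        ((ρ ^ 2 / DD c p) ^ ((n : ℝ) / 2)) ^ tau n * f (v (TT c ρ p)))) := by
  have cfv := hf.cont_comp hv vpos
  have c1 : ContinuousOn (fun p : ℝ × ℝ => p.1 ^ ((n : ℝ) / 2) * w p) HP :=
    (cont_rpow_HP _).mul hw.continuousOn
  have c2 : ContinuousOn (fun p : ℝ × ℝ => -(1 / 4) * p.1 ^ ((n : ℝ) / 2 + 1) * f (v p)) HP :=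
    (continuousOn_const.mul (cont_rpow_HP _)).mul cfv.continuousOn
  have mt : MapsTo (TT c ρ) HP HP := fun p hp => TT_mem hρ hp
  refine (h.sub (h.comp_TT c hρ) c1 (c1.comp continuousOn_TT mt) c2
    (c2.comp continuousOn_TT mt)).congr (fun p hp => ?_) (fun p hp => ?_)
  · rw [TT_fst_rpow hp]; unfold UU; ring
  · have := DD_pos (c := c) hp
    rw [TT_fst_rpow hp, k_tau hn (by positivity)]; ring

lemma step {n : ℕ} {w v : ℝ × ℝ → ℝ} {f : ℝ → ℝ} (hf : Nice n f) (hn : 1 ≤ n)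
    (hw : Continuous w) (wpos : ∀ p, 0 < w p) (hv : Continuous v) (vpos : ∀ p, 0 < v p)
    {c ρ : ℝ} (hρ : 0 < ρ)
    (h : WeakEq ((n : ℝ) / 2) (fun p => p.1 ^ ((n : ℝ) / 2) * w p)
      (fun p => -(1 / 4) * p.1 ^ ((n : ℝ) / 2 + 1) * f (v p)))
    {W C M r : ℝ} (hW : ∀ p ∈ HP, DD c p < ρ ^ 2 → w p ≤ W)
    (near : ∀ p ∈ HP, DD c p ≤ r → UU ((n : ℝ) / 2) c ρ w p ≤ 0)
    (hC : ∀ p ∈ HP, DD c p < ρ ^ 2 → tau n * f (v p) / v p ≤ C) (hC0 : 0 ≤ C) (hCρ : C * ρ ≤ 2)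
    (hM0 : 0 ≤ M) (hM : ∀ p ∈ HP, DD c p < ρ ^ 2 → UU ((n : ℝ) / 2) c ρ v p ≤ M) :
    ∀ p ∈ HP, DD c p < ρ ^ 2 → UU ((n : ℝ) / 2) c ρ w p ≤ M / 2 := by
  have hn' : (1 : ℝ) ≤ n := by exact_mod_cast hn
  have cfv := hf.cont_comp hv vpos
  have mt : MapsTo (TT c ρ) HP HP := fun p hp => TT_mem hρ hp
  have cF : ContinuousOn (fun p : ℝ × ℝ => -(1 / 4) * p.1 ^ ((n : ℝ) / 2 + 1) * (f (v p) -
        ((ρ ^ 2 / DD c p) ^ ((n : ℝ) / 2)) ^ tau n * f (v (TT c ρ p)))) HP := by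
    refine (continuousOn_const.mul (cont_rpow_HP _)).mul (cfv.continuousOn.sub
      (ContinuousOn.mul ?_ (cfv.comp_continuousOn continuousOn_TT)))
    refine (cont_k _ c hρ).rpow_const fun p hp => ?_
    have := DD_pos (c := c) hp
    exact Or.inl (by positivity)
  have Ωo : IsOpen (HP ∩ {p | r < DD c p ∧ DD c p < ρ ^ 2}) :=
    isOpen_HP.inter ((isOpen_lt continuous_const (continuous_DD c)).inter
      (isOpen_lt (continuous_DD c) continuous_const))
  have key := WMP hn (weakEq_UU hf hn hw hv vpos c hρ h) (cont_UU _ c hρ hw) cF Ωo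
    inter_subset_left (ρ := ρ) (B := W) (m := 0) (A := C * M / 4) ?_ hρ ?_ ?_ ?_ (by positivity) ?_
  · intro p hp hD
    rcases le_or_gt (DD c p) r with hr | hr
    · have := near p hp hr
      linarith
    · refine (key p ⟨hp, hr, hD⟩).trans ?_
      rw [zero_add, div_le_iff₀ (by linarith)]
      nlinarith [mul_nonneg hM0 (by linarith : (0 : ℝ) ≤ n - 1)]
  · exact (isCompact_DD c (ρ ^ 2)).isBounded.subset fun p hp =>
      show DD c p ≤ ρ ^ 2 from le_of_lt hp.2.2
  · intro p hp
    have h2 : DD c p < ρ ^ 2 := hp.2.2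
    unfold DD at h2
    nlinarith [sq_nonneg (p.2 - c)]
  · intro p hp
    have h1 := hW p hp.1 hp.2.2
    have := DD_pos (c := c) hp.1
    have := wpos (TT c ρ p)
    have : 0 ≤ (ρ ^ 2 / DD c p) ^ ((n : ℝ) / 2) * w (TT c ρ p) := by positivity
    unfold UU; linarith
  · intro p hpc hpn hpH
    have h1 : DD c p ≤ ρ ^ 2 := by
      have : closure (HP ∩ {p | r < DD c p ∧ DD c p < ρ ^ 2}) ⊆ {p | DD c p ≤ ρ ^ 2} :=
        closure_minimal (fun p hp => show DD c p ≤ ρ ^ 2 from le_of_lt hp.2.2)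
          (isClosed_le (continuous_DD c) continuous_const)
      exact this hpc
    rcases le_or_gt (DD c p) r with hr | hr
    · exact near p hpH hr
    · have h2 : DD c p = ρ ^ 2 := by
        by_contra hc
        exact hpn ⟨hpH, hr, lt_of_le_of_ne h1 hc⟩
      unfold UU
      rw [TT_fix hρ h2, h2, div_self (by positivity), one_rpow]; simp
  · rintro p ⟨hp, -, hD⟩
    have hDp := DD_pos (c := c) hp
    have h0 : 0 < p.1 := hp
    have k1 : 1 ≤ (ρ ^ 2 / DD c p) ^ ((n : ℝ) / 2) := by
      apply one_le_rpow _ (by positivity)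
      rw [le_div_iff₀ hDp]; linarith
    have h1 := hf.key hn (vpos p) (vpos (TT c ρ p)) k1
    have h2 := hM p hp hD
    unfold UU at h2
    have h3 := hC p hp hD
    have h4 : 0 ≤ tau n * f (v p) / v p := by
      have := hf.nonneg hn (vpos p)
      have := vpos p
      have := tau_gt hn
      positivity
    have h5 : f (v p) - ((ρ ^ 2 / DD c p) ^ ((n : ℝ) / 2)) ^ tau n * f (v (TT c ρ p)) ≤ C * M := by
      refine h1.trans ?_
      gcongr
      exact max_le h2 hM0
    have h6 : 0 < p.1 ^ ((n : ℝ) / 2 + 1) := by positivity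
    nlinarith

lemma near_bound {n : ℕ} (hn : 1 ≤ n) {w : ℝ × ℝ → ℝ} {δ W ρ : ℝ} (hδ : 0 < δ)
    (low : ∀ p ∈ HP, 1 ≤ DD 0 p → δ ≤ DD 0 p ^ ((n : ℝ) / 2) * w p)
    (hρ : 0 < ρ) (hρ1 : ρ ≤ 1 / 2) (hW : ∀ p, DD 0 p ≤ 5 → w p ≤ W) (hsm : 2 * ρ * W ≤ δ) :
    ∀ p ∈ HP, DD (-ρ) p ≤ ρ ^ 4 / 4 → UU ((n : ℝ) / 2) (-ρ) ρ w p ≤ 0 := by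
  intro p hp hD
  have hn' : (1 : ℝ) ≤ n := by exact_mod_cast hn
  have hDp := DD_pos (c := -ρ) hp
  set q := TT (-ρ) ρ p with hq
  have qH : q ∈ HP := TT_mem hρ hp
  have e : DD (-ρ) q = ρ ^ 4 / DD (-ρ) p := DD_TT hDp
  have h4 : 4 ≤ DD (-ρ) q := by
    rw [e, le_div_iff₀ hDp]; linarith
  have h5 : DD 0 q ≤ 4 * DD (-ρ) q := by
    unfold DD at h4 ⊢
    nlinarith [sq_nonneg (q.2 + ρ + ρ), sq_nonneg q.1]
  have h6 : 1 ≤ DD 0 q := by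
    unfold DD at h4 ⊢
    nlinarith [sq_nonneg (q.2 - ρ), sq_nonneg q.1]
  have l := low q qH h6
  have hD5 : DD 0 p ≤ 5 := by
    have h7 : DD (-ρ) p ≤ 1 := by
      have : ρ ^ 4 ≤ 1 := pow_le_one₀ hρ.le (by linarith)
      linarith
    unfold DD at h7 ⊢
    nlinarith [sq_nonneg (p.2 + ρ + ρ), sq_nonneg p.1]
  have hWp := hW p hD5
  have wq : 0 < w q := by
    have : 0 < DD 0 q ^ ((n : ℝ) / 2) := by
      have := DD_pos (c := 0) qH
      positivity
    by_contra hc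
    push Not at hc
    nlinarith
  -- (ρ²/D)^a w(q) ≥ δ (1/(4ρ²))^a
  have e2 : ρ ^ 2 / DD (-ρ) p = DD (-ρ) q / ρ ^ 2 := by
    rw [e]; field_simp
  have h8 : DD 0 q * (1 / (2 * ρ)) ^ (2 : ℕ) ≤ ρ ^ 2 / DD (-ρ) p := by
    rw [e2, le_div_iff₀ (by positivity)]
    have : (1 / (2 * ρ)) ^ 2 * ρ ^ 2 = 1 / 4 := by field_simp; norm_num
    rw [mul_assoc, this]; linarith
  have h9 : DD 0 q ^ ((n : ℝ) / 2) * (1 / (2 * ρ)) ≤ (ρ ^ 2 / DD (-ρ) p) ^ ((n : ℝ) / 2) := by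
    refine le_trans ?_ (rpow_le_rpow (by have := DD_nonneg 0 q; positivity) h8 (by positivity))
    rw [mul_rpow (DD_nonneg 0 q) (by positivity)]
    gcongr
    · rw [← rpow_natCast, ← rpow_mul (by positivity)]
      have : ((2 : ℕ) : ℝ) * ((n : ℝ) / 2) = n := by push_cast; ring
      rw [this]
      apply self_le_rpow_of_one_le _ hn'
      rw [le_div_iff₀ (by positivity)]; linarith
  unfold UU
  rw [← hq]
  have h10 : DD 0 q ^ ((n : ℝ) / 2) * (1 / (2 * ρ)) * w q ≤
    (ρ ^ 2 / DD (-ρ) p) ^ ((n : ℝ) / 2) * w q := by gcongr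
  have h11 : δ * (1 / (2 * ρ)) ≤ DD 0 q ^ ((n : ℝ) / 2) * (1 / (2 * ρ)) * w q := by
    have : DD 0 q ^ ((n : ℝ) / 2) * (1 / (2 * ρ)) * w q =
      (DD 0 q ^ ((n : ℝ) / 2) * w q) * (1 / (2 * ρ)) := by ring
    rw [this]
    gcongr
  have h12 : W ≤ δ * (1 / (2 * ρ)) := by
    rw [mul_one_div, le_div_iff₀ (by positivity)]; linarith
  linarith

lemma iterate_half {P : ℝ → Prop} {W x : ℝ} (h0 : P W) (hs : ∀ M, 0 ≤ M → P M → P (M / 2))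
    (hW : 0 ≤ W) (hx : ∀ M, P M → x ≤ M) : x ≤ 0 := by
  have h1 : ∀ k : ℕ, 0 ≤ W / 2 ^ k ∧ P (W / 2 ^ k) := by
    intro k
    induction k with
    | zero => simpa using ⟨hW, h0⟩
    | succ k ih =>
      refine ⟨by positivity, ?_⟩
      have := hs _ ih.1 ih.2
      rwa [div_div, ← pow_succ] at this
  have lim : Tendsto (fun k : ℕ => W / 2 ^ k) atTop (𝓝 0) := by
    have := (tendsto_pow_atTop_nhds_zero_of_lt_one (r := (1 / 2 : ℝ)) (by norm_num)
      (by norm_num)).const_mul W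
    simpa [div_eq_mul_inv] using this
  exact ge_of_tendsto' lim fun k => hx _ (h1 k).2

lemma DD_five {ρ : ℝ} (hρ : 0 < ρ) (hρ1 : ρ ≤ 1 / 2) {p : ℝ × ℝ} (h : DD (-ρ) p < ρ ^ 2) :
    DD 0 p ≤ 5 := by
  have h7 : DD (-ρ) p ≤ 1 := by nlinarith
  unfold DD at h7 ⊢
  nlinarith [sq_nonneg (p.2 + ρ + ρ), sq_nonneg p.1]

lemma comparison {n : ℕ} (hn : 1 ≤ n) {w v : ℝ × ℝ → ℝ} {f g : ℝ → ℝ} (hf : Nice n f)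
    (hg : Nice n g) (hw : Continuous w) (wpos : ∀ p, 0 < w p) (hv : Continuous v)
    (vpos : ∀ p, 0 < v p)
    (h : WeakEq ((n : ℝ) / 2) (fun p => p.1 ^ ((n : ℝ) / 2) * w p)
      (fun p => -(1 / 4) * p.1 ^ ((n : ℝ) / 2 + 1) * f (v p)))
    (h' : WeakEq ((n : ℝ) / 2) (fun p => p.1 ^ ((n : ℝ) / 2) * v p)
      (fun p => -(1 / 4) * p.1 ^ ((n : ℝ) / 2 + 1) * g (w p))) :
    ∃ ρ₀ > 0, ∀ ρ, 0 < ρ → ρ ≤ ρ₀ → ∀ p ∈ HP, DD (-ρ) p < ρ ^ 2 →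
      UU ((n : ℝ) / 2) (-ρ) ρ w p ≤ 0 ∧ UU ((n : ℝ) / 2) (-ρ) ρ v p ≤ 0 := by
  have cfv := hf.cont_comp hv vpos
  have cgw := hg.cont_comp hw wpos
  have cF : ContinuousOn (fun p : ℝ × ℝ => -(1 / 4) * p.1 ^ ((n : ℝ) / 2 + 1) * f (v p)) HP :=
    (continuousOn_const.mul (cont_rpow_HP _)).mul cfv.continuousOn
  have cG : ContinuousOn (fun p : ℝ × ℝ => -(1 / 4) * p.1 ^ ((n : ℝ) / 2 + 1) * g (w p)) HP :=
    (continuousOn_const.mul (cont_rpow_HP _)).mul cgw.continuousOn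
  obtain ⟨δ1, hδ1, low1⟩ := lower hn hw wpos h cF (fun p hp => by
    have h0 : 0 < p.1 := hp
    have := hf.nonneg hn (vpos p)
    have : 0 ≤ p.1 ^ ((n : ℝ) / 2 + 1) * f (v p) := by positivity
    linarith)
  obtain ⟨δ2, hδ2, low2⟩ := lower hn hv vpos h' cG (fun p hp => by
    have h0 : 0 < p.1 := hp
    have := hg.nonneg hn (wpos p)
    have : 0 ≤ p.1 ^ ((n : ℝ) / 2 + 1) * g (w p) := by positivity
    linarith)
  have hK := isCompact_DD 0 5
  have bd : ∀ F : ℝ × ℝ → ℝ, Continuous F → ∃ C, 0 < C ∧ ∀ p, DD 0 p ≤ 5 → F p ≤ C := by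
    intro F hF
    obtain ⟨C, hC⟩ := hK.exists_bound_of_continuousOn hF.continuousOn
    refine ⟨|C| + 1, by positivity, fun p hp => ?_⟩
    have h1 := hC p hp
    have h2 := le_abs_self (F p)
    have h3 := le_abs_self C
    rw [Real.norm_eq_abs] at h1
    linarith
  obtain ⟨W1, hW1, bW1⟩ := bd w hw
  obtain ⟨W2, hW2, bW2⟩ := bd v hv
  obtain ⟨C1, hC1, bC1⟩ := bd (fun p => tau n * f (v p) / v p)
    ((continuous_const.mul cfv).div₀ hv fun p => (vpos p).ne')
  obtain ⟨C2, hC2, bC2⟩ := bd (fun p => tau n * g (w p) / w p)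
    ((continuous_const.mul cgw).div₀ hw fun p => (wpos p).ne')
  refine ⟨min (1 / 2) (min (min (δ1 / (2 * W1)) (δ2 / (2 * W2))) (min (2 / C1) (2 / C2))),
    by positivity, ?_⟩
  intro ρ hρ hle p hp hDp
  simp only [le_min_iff] at hle
  obtain ⟨r1, ⟨r2, r3⟩, r4, r5⟩ := hle
  rw [le_div_iff₀ (by positivity)] at r2 r3 r4 r5
  have n1 := near_bound hn hδ1 low1 hρ r1 bW1 (by linarith)
  have n2 := near_bound hn hδ2 low2 hρ r1 bW2 (by linarith)
  set P : ℝ → Prop := fun M => (∀ p ∈ HP, DD (-ρ) p < ρ ^ 2 → UU ((n : ℝ) / 2) (-ρ) ρ w p ≤ M) ∧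
    (∀ p ∈ HP, DD (-ρ) p < ρ ^ 2 → UU ((n : ℝ) / 2) (-ρ) ρ v p ≤ M) with hP
  have ini : P (max W1 W2) := by
    constructor
    · intro p hp hD
      have h1 := bW1 p (DD_five hρ r1 hD)
      have := DD_pos (c := -ρ) hp
      have := wpos (TT (-ρ) ρ p)
      have : 0 ≤ (ρ ^ 2 / DD (-ρ) p) ^ ((n : ℝ) / 2) * w (TT (-ρ) ρ p) := by positivity
      have := le_max_left W1 W2
      unfold UU; linarith
    · intro p hp hD
      have h1 := bW2 p (DD_five hρ r1 hD)
      have := DD_pos (c := -ρ) hp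
      have := vpos (TT (-ρ) ρ p)
      have : 0 ≤ (ρ ^ 2 / DD (-ρ) p) ^ ((n : ℝ) / 2) * v (TT (-ρ) ρ p) := by positivity
      have := le_max_right W1 W2
      unfold UU; linarith
  have stp : ∀ M, 0 ≤ M → P M → P (M / 2) := by
    rintro M hM0 ⟨hM1, hM2⟩
    exact ⟨step hf hn hw wpos hv vpos hρ h (fun p _ hD => bW1 p (DD_five hρ r1 hD)) n1
      (fun p _ hD => bC1 p (DD_five hρ r1 hD)) hC1.le (by linarith) hM0 hM2,
      step hg hn hv vpos hw wpos hρ h' (fun p _ hD => bW2 p (DD_five hρ r1 hD)) n2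
      (fun p _ hD => bC2 p (DD_five hρ r1 hD)) hC2.le (by linarith) hM0 hM1⟩
  have hW0 : 0 ≤ max W1 W2 := le_max_of_le_left hW1.le
  exact ⟨iterate_half ini stp hW0 fun M hM => hM.1 p hp hDp,
    iterate_half ini stp hW0 fun M hM => hM.2 p hp hDp⟩

end Heisenberg

end

section

open scoped ContDiff

namespace Heisenberg

variable {n : ℕ}

/-- Horizontal index set: `inl i` for `X i` and `inr i` for `Y i`. -/
abbrev Ix (n : ℕ) := Fin n ⊕ Fin n

def xc (k : Ix n) (ξ : H n) : ℝ := Sum.elim (fun i => ξ.1 i) (fun i => ξ.2.1 i) k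
def yc (k : Ix n) (ξ : H n) : ℝ := Sum.elim (fun i => ξ.2.1 i) (fun i => -ξ.1 i) k
def vec (k : Ix n) (ξ : H n) : H n :=
  Sum.elim (fun i => ((Pi.single i 1, 0, 2 * ξ.2.1 i) : H n))
    (fun i => (0, Pi.single i 1, -(2 * ξ.1 i))) k
def Zd (k : Ix n) (φ : H n → ℝ) (ξ : H n) : ℝ := fderiv ℝ φ ξ (vec k ξ)
def Gc (k : Ix n) (a : (Fin n → ℝ) × (Fin n → ℝ)) : ℝ := Sum.elim a.1 a.2 k

lemma Zd_inl (i : Fin n) (φ : H n → ℝ) : Zd (Sum.inl i) φ = Xd i φ := rfl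
lemma Zd_inr (i : Fin n) (φ : H n → ℝ) : Zd (Sum.inr i) φ = Yd i φ := rfl

lemma hdot_eq (a : (Fin n → ℝ) × (Fin n → ℝ)) (φ : H n → ℝ) (ξ : H n) :
    hdot a (hGrad φ ξ) = ∑ k, Gc k a * Zd k φ ξ := by
  simp [hdot, Gc, Zd_inl, Zd_inr, hGrad, Fintype.sum_sum_type]

lemma subLap_eq (φ : H n → ℝ) (ξ : H n) : subLap φ ξ = ∑ k, Zd k (Zd k φ) ξ := by
  simp [subLap, Zd_inl, Zd_inr, Fintype.sum_sum_type]

lemma abs_Gc_le (k : Ix n) (a : (Fin n → ℝ) × (Fin n → ℝ)) : |Gc k a| ≤ ‖a‖ := by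
  rcases k with i | i
  · exact (norm_le_pi_norm a.1 i).trans (norm_fst_le a)
  · exact (norm_le_pi_norm a.2 i).trans (norm_snd_le a)

lemma contDiff_vec (k : Ix n) : ContDiff ℝ ∞ (vec k : H n → H n) := by
  rcases k with i | i
  · show ContDiff ℝ ∞ (fun ξ : H n => ((Pi.single i 1, 0, 2 * ξ.2.1 i) : H n))
    fun_prop
  · show ContDiff ℝ ∞ (fun ξ : H n => ((0, Pi.single i 1, -(2 * ξ.1 i)) : H n))
    fun_prop

lemma contDiff_Zd (k : Ix n) {φ : H n → ℝ} (h : ContDiff ℝ ∞ φ) : ContDiff ℝ ∞ (Zd k φ) :=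
  (h.fderiv_right (m := ∞) (by simp)).clm_apply (contDiff_vec k)

lemma tsupport_Zd (k : Ix n) (φ : H n → ℝ) : tsupport (Zd k φ) ⊆ tsupport φ := by
  refine closure_minimal (fun ξ h => ?_) (isClosed_tsupport φ)
  apply support_fderiv_subset ℝ
  intro hc
  apply h
  simp [Zd, hc]

lemma test_of {φ : H n → ℝ} (h : ContDiff ℝ ∞ φ) (hc : HasCompactSupport φ) :
    IsTest (n := n) univ φ := ⟨h.of_le (by simp), hc, subset_univ _⟩

lemma test_Zd (k : Ix n) {φ : H n → ℝ} (hc : HasCompactSupport φ) :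
    HasCompactSupport (Zd k φ) := hc.of_isClosed_subset (isClosed_tsupport _) (tsupport_Zd k φ)

lemma test_add {φ ψ : H n → ℝ} (h : IsTest (n := n) univ φ) (h' : IsTest (n := n) univ ψ) :
    IsTest (n := n) univ (fun ξ => φ ξ + ψ ξ) :=
  ⟨h.contDiff.add h'.contDiff, h.compactSupport.add h'.compactSupport, subset_univ _⟩

lemma Zd_add (k : Ix n) {φ ψ : H n → ℝ} (h : IsTest (n := n) univ φ) (h' : IsTest (n := n) univ ψ) :
    Zd k (fun ξ => φ ξ + ψ ξ) = fun ξ => Zd k φ ξ + Zd k ψ ξ := by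
  funext ξ
  unfold Zd
  rw [fderiv_fun_add (h.contDiff.differentiable (by simp) ξ) (h'.contDiff.differentiable (by simp) ξ)]
  rfl

lemma continuous_Zd1 (k : Ix n) {φ : H n → ℝ} (h : ContDiff ℝ 1 φ) : Continuous (Zd k φ) :=
  (h.continuous_fderiv (by simp)).clm_apply (contDiff_vec k).continuous

lemma integrable_uZ (k : Ix n) {u φ : H n → ℝ} (hu : Continuous u) (h : IsTest (n := n) univ φ) :
    Integrable (fun ξ => u ξ * Zd k φ ξ) := by
  apply Continuous.integrable_of_hasCompactSupport (hu.mul (continuous_Zd1 k h.contDiff))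
  have h2 : HasCompactSupport (Zd k φ) :=
    h.compactSupport.of_isClosed_subset (isClosed_tsupport _) (tsupport_Zd k φ)
  exact h2.mul_left

lemma integrable_Gc (k : Ix n) {G : H n → (Fin n → ℝ) × (Fin n → ℝ)}
    (sq : ∀ K : Set (H n), IsCompact K → IntegrableOn (fun ξ => ‖G ξ‖ ^ 2) K)
    {φ : H n → ℝ} (h : IsTest (n := n) univ φ)
    (m : AEStronglyMeasurable (fun ξ => Gc k (G ξ) * φ ξ) volume) :
    Integrable (fun ξ => Gc k (G ξ) * φ ξ) := by
  obtain ⟨C, hC⟩ := h.compactSupport.exists_bound_of_continuous h.contDiff.continuous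
  have hK : IsCompact (tsupport φ) := h.compactSupport
  have C0 : 0 ≤ C := (norm_nonneg _).trans (hC 0)
  have hi : IntegrableOn (fun ξ => C * (1 + ‖G ξ‖ ^ 2)) (tsupport φ) :=
    (((integrableOn_const_iff (C := (1 : ℝ))).2 (Or.inr hK.measure_lt_top)).add (sq _ hK)).const_mul C
  refine ((integrable_indicator_iff hK.measurableSet).2 hi).mono' m (ae_of_all _ fun ξ => ?_)
  by_cases hξ : ξ ∈ tsupport φ
  · rw [indicator_of_mem hξ, norm_mul, mul_comm]
    have := abs_Gc_le k (G ξ)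
    rw [← Real.norm_eq_abs] at this
    apply mul_le_mul (hC ξ) _ (norm_nonneg _) C0
    nlinarith [sq_nonneg (‖G ξ‖ - 1)]
  · rw [indicator_of_notMem hξ, image_eq_zero_of_notMem_tsupport hξ]; simp

lemma contDiff_xc (k : Ix n) : ContDiff ℝ ∞ (xc k : H n → ℝ) := by
  rcases k with i | i
  · show ContDiff ℝ ∞ (fun ξ : H n => ξ.1 i)
    fun_prop
  · show ContDiff ℝ ∞ (fun ξ : H n => ξ.2.1 i)
    fun_prop

lemma contDiff_yc (k : Ix n) : ContDiff ℝ ∞ (yc k : H n → ℝ) := by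
  rcases k with i | i
  · show ContDiff ℝ ∞ (fun ξ : H n => ξ.2.1 i)
    fun_prop
  · show ContDiff ℝ ∞ (fun ξ : H n => -ξ.1 i)
    fun_prop

lemma line_deriv {φ : H n → ℝ} {ξ : H n} (h : DifferentiableAt ℝ φ ξ) (v : H n) {c : ℝ}
    (h' : HasDerivAt (fun s : ℝ => φ (ξ + s • v)) c 0) : fderiv ℝ φ ξ v = c := by
  have h1 := h.hasFDerivAt.hasLineDerivAt v
  exact HasDerivAt.unique h1 h'

lemma Zd_xc (j k : Ix n) (ξ : H n) : Zd j (xc k) ξ = if j = k then 1 else 0 := by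
  apply line_deriv ((contDiff_xc k).differentiable (by simp) ξ)
  have e : (fun s : ℝ => xc k (ξ + s • vec j ξ)) =
      fun s => xc k ξ + s * (if j = k then 1 else 0) := by
    funext s
    rcases j with i | i <;> rcases k with l | l <;>
      simp [xc, vec, Pi.single_apply, eq_comm]
  rw [e]
  simpa using ((hasDerivAt_id (0 : ℝ)).mul_const (if j = k then (1 : ℝ) else 0)).const_add (xc k ξ)

lemma Zd_congr (j : Ix n) {φ ψ : H n → ℝ} {ξ : H n} (h : φ =ᶠ[𝓝 ξ] ψ) : Zd j φ ξ = Zd j ψ ξ := by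
  unfold Zd; rw [h.fderiv_eq]

/-- the dichotomy -/
lemma weak_to_dist {u F : H n → ℝ} (hu : Continuous u) (hF : Continuous F)
    (h : IsWeakSol univ u F) :
    (∀ φ : H n → ℝ, ContDiff ℝ ∞ φ → HasCompactSupport φ →
      ∫ ξ, u ξ * subLap φ ξ = -∫ ξ, F ξ * φ ξ) ∨
    (∃ k : Ix n, ∀ φ : H n → ℝ, IsTest univ φ → ∫ ξ, u ξ * Zd k φ ξ = 0 ∧ ∫ ξ, F ξ * φ ξ = 0) := by
  obtain ⟨G, hG, hs⟩ := h
  have sq : ∀ K : Set (H n), IsCompact K → IntegrableOn (fun ξ => ‖G ξ‖ ^ 2) K :=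
    fun K hK => hG.locSq K (subset_univ _) hK
  have ibp : ∀ k : Ix n, ∀ φ : H n → ℝ, IsTest univ φ →
      ∫ ξ, u ξ * Zd k φ ξ = -∫ ξ, Gc k (G ξ) * φ ξ := by
    rintro (i | i) φ hφ
    · exact hG.ibpX i φ hφ
    · exact hG.ibpY i φ hφ
  by_cases hm : ∀ k : Ix n, ∀ φ : H n → ℝ, IsTest univ φ →
      AEStronglyMeasurable (fun ξ => Gc k (G ξ) * φ ξ) volume
  · left
    intro φ h1 h2
    have t : ∀ k : Ix n, IsTest univ (Zd k φ) := fun k => test_of (contDiff_Zd k h1) (test_Zd k h2)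
    have e1 : ∀ ξ, u ξ * subLap φ ξ = ∑ k, u ξ * Zd k (Zd k φ) ξ := by
      intro ξ; rw [subLap_eq, Finset.mul_sum]
    simp_rw [e1]
    rw [integral_finsetSum _ (fun k _ => integrable_uZ k hu (t k))]
    rw [← hs φ (test_of h1 h2)]
    simp_rw [hdot_eq]
    rw [integral_finsetSum _ (fun k _ => integrable_Gc k sq (t k) (hm k _ (t k))),
      ← Finset.sum_neg_distrib]
    exact Finset.sum_congr rfl fun k _ => ibp k _ (t k)
  · right
    push Not at hm
    obtain ⟨k, φ0, hφ0, hn⟩ := hm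
    refine ⟨k, fun φ hφ => ⟨?_, ?_⟩⟩
    · have key : ∀ θ : H n → ℝ, IsTest univ θ →
        ¬ AEStronglyMeasurable (fun ξ => Gc k (G ξ) * θ ξ) volume → ∫ ξ, u ξ * Zd k θ ξ = 0 := by
        intro θ h1 h2
        rw [ibp k θ h1, integral_undef (fun hi => h2 hi.1), neg_zero]
      by_cases hmm : AEStronglyMeasurable (fun ξ => Gc k (G ξ) * φ ξ) volume
      · have h3 : ¬ AEStronglyMeasurable (fun ξ => Gc k (G ξ) * (φ ξ + φ0 ξ)) volume := by
          intro hc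
          apply hn
          refine (hc.sub hmm).congr (ae_of_all _ fun ξ => ?_)
          simp only [Pi.sub_apply]; ring
        have h4 := key _ (test_add hφ hφ0) h3
        rw [Zd_add k hφ hφ0] at h4
        simp_rw [mul_add] at h4
        rw [integral_add (integrable_uZ k hu hφ) (integrable_uZ k hu hφ0), key _ hφ0 hn, add_zero] at h4
        exact h4
      · exact key _ hφ hmm
    · by_contra hne
      have iF : ∀ φ : H n → ℝ, IsTest univ φ → Integrable (fun ξ => F ξ * φ ξ) := fun φ h1 =>
        (hF.mul h1.contDiff.continuous).integrable_of_hasCompactSupport h1.compactSupport.mul_left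
      have h1 : ∀ θ : H n → ℝ, IsTest univ θ → ∫ ξ, F ξ * θ ξ ≠ 0 →
          AEStronglyMeasurable (fun ξ => hdot (G ξ) (hGrad θ ξ)) volume := by
        intro θ ht h2
        rw [← hs θ ht] at h2
        by_contra hc
        exact h2 (integral_undef fun hi => hc hi.1)
      have h2 : ∀ θ : H n → ℝ, IsTest univ θ →
          AEStronglyMeasurable (fun ξ => hdot (G ξ) (hGrad θ ξ)) volume := by
        intro θ ht
        by_cases h3 : ∫ ξ, F ξ * θ ξ = 0
        · have h4 : ∫ ξ, F ξ * (θ ξ + φ ξ) ≠ 0 := by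
            simp_rw [mul_add]
            rw [integral_add (iF θ ht) (iF φ hφ), h3, zero_add]; exact hne
          refine ((h1 _ (test_add ht hφ) h4).sub (h1 _ hφ hne)).congr (ae_of_all _ fun ξ => ?_)
          simp only [Pi.sub_apply, hdot_eq, Zd_add _ ht hφ, mul_add, Finset.sum_add_distrib]; ring
        · exact h1 θ ht h3
      obtain ⟨R, hR⟩ := hφ0.compactSupport.isBounded.subset_closedBall (0 : H n)
      have R1 : 0 < max R 0 + 1 := by positivity
      let χ : ContDiffBump (0 : H n) := ⟨max R 0 + 1, max R 0 + 2, R1, by linarith⟩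
      have t : IsTest (n := n) univ (fun ξ => χ ξ * xc k ξ) :=
        test_of (χ.contDiff.mul (contDiff_xc k)) (χ.hasCompactSupport.mul_right)
      apply hn
      refine ((h2 _ t).mul hφ0.contDiff.continuous.aestronglyMeasurable).congr
        (ae_of_all _ fun ξ => ?_)
      simp only [Pi.mul_apply]
      by_cases hξ : ξ ∈ tsupport φ0
      · congr 1
        have hb : (fun ξ => χ ξ * xc k ξ) =ᶠ[𝓝 ξ] xc k := by
          have : Metric.ball (0 : H n) (max R 0 + 1) ∈ 𝓝 ξ := by
            apply Metric.isOpen_ball.mem_nhds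
            have := hR hξ
            rw [Metric.mem_closedBall] at this
            rw [Metric.mem_ball]
            linarith [le_max_left R 0]
          filter_upwards [this] with η hη
          rw [χ.one_of_mem_closedBall (Metric.ball_subset_closedBall hη), one_mul]
        simp [hdot_eq, Zd_congr _ hb, Zd_xc]
      · rw [image_eq_zero_of_notMem_tsupport hξ]; simp
end Heisenberg

end

section

open scoped ContDiff

namespace Heisenberg

variable {n : ℕ}

/-- The cylindrical coordinates `(r², t)`. -/
def PP (ξ : H n) : ℝ × ℝ := (rsq ξ, ξ.2.2)

lemma contDiff_PP : ContDiff ℝ ∞ (PP : H n → ℝ × ℝ) := by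
  unfold PP rsq
  fun_prop

lemma rsq_eq (ξ : H n) : rsq ξ = ∑ k, xc k ξ ^ 2 := by
  simp [rsq, xc, Fintype.sum_sum_type]

lemma rsq_eq' (ξ : H n) : rsq ξ = ∑ k, yc k ξ ^ 2 := by
  simp [rsq, yc, Fintype.sum_sum_type, add_comm]

lemma sum_xy (ξ : H n) : ∑ k, xc k ξ * yc k ξ = 0 := by
  simp [xc, yc, Fintype.sum_sum_type, mul_comm]

lemma rsq_nonneg (ξ : H n) : 0 ≤ rsq ξ := by
  rw [rsq_eq]; positivity

lemma vec_t (k : Ix n) (ξ : H n) : (vec k ξ).2.2 = 2 * yc k ξ := by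
  rcases k with i | i <;> simp [vec, yc]

lemma xc_line (j k : Ix n) (ξ : H n) (s : ℝ) :
    xc k (ξ + s • vec j ξ) = xc k ξ + s * (if j = k then 1 else 0) := by
  rcases j with i | i <;> rcases k with l | l <;>
      simp [xc, vec, Pi.single_apply, eq_comm]

lemma yc_line (k : Ix n) (ξ : H n) (s : ℝ) : yc k (ξ + s • vec k ξ) = yc k ξ := by
  rcases k with i | i <;> simp [yc, vec]

lemma rsq_line (k : Ix n) (ξ : H n) (s : ℝ) :
    rsq (ξ + s • vec k ξ) = rsq ξ + 2 * s * xc k ξ + s ^ 2 := by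
  rw [rsq_eq, rsq_eq]
  have : ∀ j : Ix n, xc j (ξ + s • vec k ξ) ^ 2 = xc j ξ ^ 2 + if k = j then 2 * s * xc j ξ + s ^ 2 else 0 := by
    intro j
    rw [xc_line]
    split_ifs <;> ring
  simp_rw [this, Finset.sum_add_distrib]
  simp [add_assoc]

lemma PP_line (k : Ix n) (ξ : H n) :
    HasDerivAt (fun s : ℝ => PP (ξ + s • vec k ξ)) (2 * xc k ξ, 2 * yc k ξ) 0 := by
  apply HasDerivAt.prodMk
  · simp_rw [rsq_line]
    have h1 := (((hasDerivAt_id (0 : ℝ)).const_mul 2).mul_const (xc k ξ)).const_add (rsq ξ)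
    have h2 := (hasDerivAt_id (0 : ℝ)).pow 2
    have h3 := h1.add h2
    simp only [id, mul_zero, mul_one, Nat.cast_ofNat, pow_one, add_zero, Nat.add_one_sub_one] at h3
    exact h3
  · have h1 := ((hasDerivAt_id (0 : ℝ)).mul_const (2 * yc k ξ)).const_add (ξ.2.2)
    simpa [vec_t] using h1

lemma fderiv_split (ψ : ℝ × ℝ → ℝ) (p : ℝ × ℝ) (a b : ℝ) :
    fderiv ℝ ψ p (a, b) = a * dS ψ p + b * dT ψ p := by
  have : ((a, b) : ℝ × ℝ) = a • ((1 : ℝ), (0 : ℝ)) + b • ((0 : ℝ), (1 : ℝ)) := by simp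
  rw [this, map_add, map_smul, map_smul]; rfl

lemma cyl_line {ψ : ℝ × ℝ → ℝ} (h : ContDiff ℝ ∞ ψ) (k : Ix n) (ξ : H n) :
    HasDerivAt (fun s : ℝ => ψ (PP (ξ + s • vec k ξ)))
      (2 * xc k ξ * dS ψ (PP ξ) + 2 * yc k ξ * dT ψ (PP ξ)) 0 := by
  rw [← fderiv_split]
  have h1 : HasFDerivAt ψ (fderiv ℝ ψ (PP ξ)) (PP (ξ + (0 : ℝ) • vec k ξ)) := by
    simpa using (h.differentiable (by simp) (PP ξ)).hasFDerivAt
  exact h1.comp_hasDerivAt 0 (PP_line k ξ)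

lemma Zd_cyl {ψ : ℝ × ℝ → ℝ} (h : ContDiff ℝ ∞ ψ) (k : Ix n) (ξ : H n) :
    Zd k (fun ξ => ψ (PP ξ)) ξ = 2 * xc k ξ * dS ψ (PP ξ) + 2 * yc k ξ * dT ψ (PP ξ) :=
  line_deriv ((h.comp contDiff_PP).differentiable (by simp) ξ) _ (cyl_line h k ξ)

lemma ZZ_cyl {ψ : ℝ × ℝ → ℝ} (h : ContDiff ℝ ∞ ψ) (k : Ix n) (ξ : H n) :
    Zd k (Zd k (fun ξ => ψ (PP ξ))) ξ = 2 * dS ψ (PP ξ)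
      + 4 * xc k ξ ^ 2 * dS (dS ψ) (PP ξ) + 4 * (xc k ξ * yc k ξ) * (dT (dS ψ) (PP ξ) + dS (dT ψ) (PP ξ))
      + 4 * yc k ξ ^ 2 * dT (dT ψ) (PP ξ) := by
  have hS := contDiff_dS h
  have hT := contDiff_dT h
  rw [show Zd k (fun ξ => ψ (PP ξ)) = fun ξ => 2 * xc k ξ * dS ψ (PP ξ) + 2 * yc k ξ * dT ψ (PP ξ)
    from funext (Zd_cyl h k)]
  have cd : ContDiff ℝ ∞ (fun ξ : H n => 2 * xc k ξ * dS ψ (PP ξ) + 2 * yc k ξ * dT ψ (PP ξ)) :=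
    ((contDiff_const.mul (contDiff_xc k)).mul (hS.comp contDiff_PP)).add
      ((contDiff_const.mul (contDiff_yc k)).mul (hT.comp contDiff_PP))
  apply line_deriv (cd.differentiable (by simp) ξ)
  simp_rw [yc_line, xc_line]
  have h1 := (((hasDerivAt_id (0 : ℝ)).add_const (xc k ξ)).const_mul 2).mul (cyl_line hS k ξ)
  have h2 := (cyl_line hT k ξ).const_mul (2 * yc k ξ)
  refine HasDerivAt.congr_deriv (HasDerivAt.congr_of_eventuallyEq (h1.add h2)
    (Eventually.of_forall fun s => ?_)) ?_
  · simp only [Pi.add_apply, Pi.mul_apply, id, if_true, mul_one]; ring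
  · simp; ring

lemma subLap_cyl {ψ : ℝ × ℝ → ℝ} (h : ContDiff ℝ ∞ ψ) (ξ : H n) :
    subLap (fun ξ => ψ (PP ξ)) ξ = 4 * (rsq ξ * (dS (dS ψ) (PP ξ) + dT (dT ψ) (PP ξ))
      + n * dS ψ (PP ξ)) := by
  rw [subLap_eq]
  simp_rw [ZZ_cyl h]
  simp only [Finset.sum_add_distrib, ← Finset.sum_mul, ← Finset.mul_sum]
  rw [sum_xy, ← rsq_eq, ← rsq_eq']
  simp
  ring

lemma hcs_cyl {ψ : ℝ × ℝ → ℝ} (h : HasCompactSupport ψ) :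
    HasCompactSupport (fun ξ : H n => ψ (PP ξ)) := by
  obtain ⟨R, hR⟩ := h.isBounded.subset_closedBall 0
  apply HasCompactSupport.of_support_subset_isCompact (isCompact_closedBall (0 : H n) (max R 0 + 1))
  intro ξ hξ
  have h1 : PP ξ ∈ Metric.closedBall (0 : ℝ × ℝ) R := hR (subset_tsupport _ hξ)
  rw [mem_closedBall_zero_iff, Prod.norm_def, sup_le_iff] at h1
  obtain ⟨h1, h2⟩ := h1
  simp only [PP, Real.norm_eq_abs] at h1 h2
  rw [abs_of_nonneg (rsq_nonneg ξ)] at h1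
  have hM : R ≤ max R 0 := le_max_left _ _
  have hM0 : 0 ≤ max R 0 := le_max_right _ _
  have h3 : ∀ k : Ix n, |xc k ξ| ≤ max R 0 + 1 := by
    intro k
    have : xc k ξ ^ 2 ≤ rsq ξ := by
      rw [rsq_eq]
      exact Finset.single_le_sum (f := fun k => xc k ξ ^ 2) (fun k _ => sq_nonneg _) (Finset.mem_univ k)
    apply abs_le_of_sq_le_sq _ (by positivity)
    nlinarith
  rw [mem_closedBall_zero_iff, Prod.norm_def, Prod.norm_def, sup_le_iff, sup_le_iff]
  refine ⟨?_, ?_, ?_⟩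
  · exact (pi_norm_le_iff_of_nonneg (by positivity)).2 fun i => h3 (Sum.inl i)
  · exact (pi_norm_le_iff_of_nonneg (by positivity)).2 fun i => h3 (Sum.inr i)
  · rw [Real.norm_eq_abs]; linarith

/-- rotation `(x,y,t) ↦ (y,-x,t)` -/
lemma sym_rot (Φ : ℝ → ℝ → ℝ → ℝ → ℝ) (i : Fin n) :
    ∫ ξ : H n, Φ (rsq ξ) ξ.2.2 (xc (Sum.inl i) ξ) (yc (Sum.inl i) ξ) =
    ∫ ξ : H n, Φ (rsq ξ) ξ.2.2 (xc (Sum.inr i) ξ) (yc (Sum.inr i) ξ) := by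
  let e : H n ≃ᵐ H n :=
    { toFun := fun ξ => (ξ.2.1, -ξ.1, ξ.2.2)
      invFun := fun ξ => (-ξ.2.1, ξ.1, ξ.2.2)
      left_inv := fun ξ => by simp
      right_inv := fun ξ => by simp
      measurable_toFun := by
        show Measurable (fun ξ : H n => ((ξ.2.1, -ξ.1, ξ.2.2) : H n))
        fun_prop
      measurable_invFun := by
        show Measurable (fun ξ : H n => ((-ξ.2.1, ξ.1, ξ.2.2) : H n))
        fun_prop }
  have he : MeasurePreserving e volume volume := by
    have h1 := (MeasureTheory.volume_preserving_prodAssoc (α₁ := Fin n → ℝ) (β₁ := Fin n → ℝ) (γ₁ := ℝ))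
    have h2 : MeasurePreserving (fun p : (Fin n → ℝ) × (Fin n → ℝ) => (p.2, -p.1)) volume volume := by
      have a1 : MeasurePreserving (Prod.swap : (Fin n → ℝ) × (Fin n → ℝ) → _) volume volume :=
        Measure.measurePreserving_swap
      have a2 : MeasurePreserving (Prod.map (id : (Fin n → ℝ) → _) (Neg.neg : (Fin n → ℝ) → _))
        volume volume := (MeasurePreserving.id volume).prod (Measure.measurePreserving_neg volume)
      exact a2.comp a1
    have h3 : MeasurePreserving (Prod.map (fun p : (Fin n → ℝ) × (Fin n → ℝ) => (p.2, -p.1)) (id : ℝ → ℝ))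
      volume volume := h2.prod (MeasurePreserving.id volume)
    exact (h1.comp h3).comp (h1.symm _)
  rw [← he.integral_comp e.measurableEmbedding]
  congr 1; funext ξ
  have : rsq (e ξ) = rsq ξ := by
    show rsq ((ξ.2.1, -ξ.1, ξ.2.2) : H n) = _
    simp [rsq, add_comm]
  rw [this]; rfl

lemma sym_perm (Φ : ℝ → ℝ → ℝ → ℝ → ℝ) (i j : Fin n) :
    ∫ ξ : H n, Φ (rsq ξ) ξ.2.2 (xc (Sum.inl i) ξ) (yc (Sum.inl i) ξ) =
    ∫ ξ : H n, Φ (rsq ξ) ξ.2.2 (xc (Sum.inl j) ξ) (yc (Sum.inl j) ξ) := by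
  let σ := Equiv.swap i j
  let e0 : (Fin n → ℝ) ≃ᵐ (Fin n → ℝ) := MeasurableEquiv.piCongrLeft (fun _ => ℝ) σ
  have h0 : MeasurePreserving e0 volume volume := volume_measurePreserving_piCongrLeft (fun _ => ℝ) σ
  let e : H n ≃ᵐ H n := e0.prodCongr (e0.prodCongr (MeasurableEquiv.refl ℝ))
  have he : MeasurePreserving e volume volume := h0.prod (h0.prod (MeasurePreserving.id volume))
  have ev : ∀ (x : Fin n → ℝ) (k : Fin n), e0 x (σ k) = x k := fun x k =>
    Equiv.piCongrLeft_apply_apply (fun _ => ℝ) σ x k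
  rw [← he.integral_comp e.measurableEmbedding]
  congr 1; funext ξ
  have s0 : ∀ x : Fin n → ℝ, ∑ k, (e0 x k) ^ 2 = ∑ k, x k ^ 2 := by
    intro x
    rw [← Equiv.sum_comp σ]
    simp_rw [ev]
  have : rsq (e ξ) = rsq ξ := by
    show ∑ k, (e0 ξ.1 k) ^ 2 + ∑ k, (e0 ξ.2.1 k) ^ 2 = _
    rw [s0, s0]; rfl
  rw [this]
  have hi : σ j = i := Equiv.swap_apply_right i j
  have a1 : xc (Sum.inl i) (e ξ) = xc (Sum.inl j) ξ := by
    show e0 ξ.1 i = ξ.1 j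
    rw [← hi, ev]
  have a2 : yc (Sum.inl i) (e ξ) = yc (Sum.inl j) ξ := by
    show e0 ξ.2.1 i = ξ.2.1 j
    rw [← hi, ev]
  rw [a1, a2]; rfl

lemma sym_all (Φ : ℝ → ℝ → ℝ → ℝ → ℝ) (k l : Ix n) :
    ∫ ξ : H n, Φ (rsq ξ) ξ.2.2 (xc k ξ) (yc k ξ) =
    ∫ ξ : H n, Φ (rsq ξ) ξ.2.2 (xc l ξ) (yc l ξ) := by
  rcases k with i | i <;> rcases l with j | j
  · exact sym_perm Φ i j
  · rw [← sym_rot]; exact sym_perm Φ i j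
  · rw [← sym_rot]; exact sym_perm Φ i j
  · rw [← sym_rot, ← sym_rot]; exact sym_perm Φ i j

lemma dist_cyl {w : ℝ × ℝ → ℝ} {u F : H n → ℝ} (hu : Continuous u) (hF : Continuous F)
    (huw : ∀ ξ, u ξ = w (PP ξ)) (h : IsWeakSol univ u F) {ψ : ℝ × ℝ → ℝ} (h1 : ContDiff ℝ ∞ ψ)
    (h2 : HasCompactSupport ψ) :
    ∫ ξ : H n, w (PP ξ) * (4 * (rsq ξ * (dS (dS ψ) (PP ξ) + dT (dT ψ) (PP ξ))
      + n * dS ψ (PP ξ))) = -∫ ξ, F ξ * ψ (PP ξ) := by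
  have cd : ContDiff ℝ ∞ (fun ξ : H n => ψ (PP ξ)) := h1.comp contDiff_PP
  have cs := hcs_cyl (n := n) h2
  have goal : ∫ ξ : H n, u ξ * subLap (fun ξ => ψ (PP ξ)) ξ = -∫ ξ, F ξ * ψ (PP ξ) := by
    rcases weak_to_dist hu hF h with h | ⟨k, h⟩
    · exact h _ cd cs
    · rw [(h _ (test_of cd cs)).2, neg_zero]
      have t : ∀ k : Ix n, IsTest univ (Zd k (fun ξ : H n => ψ (PP ξ))) :=
        fun k => test_of (contDiff_Zd k cd) (test_Zd k cs)
      simp_rw [subLap_eq, Finset.mul_sum]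
      rw [integral_finsetSum _ (fun k _ => integrable_uZ k hu (t k))]
      apply Finset.sum_eq_zero
      intro l _
      rw [← (h _ (t k)).1]
      simp_rw [huw, ZZ_cyl h1]
      exact sym_all (fun s t x y => w (s, t) * (2 * dS ψ (s, t)
        + 4 * x ^ 2 * dS (dS ψ) (s, t) + 4 * (x * y) * (dT (dS ψ) (s, t) + dS (dT ψ) (s, t))
        + 4 * y ^ 2 * dT (dT ψ) (s, t))) l k
  rw [← goal]
  simp_rw [subLap_cyl h1, huw]

end Heisenberg

end

section

open scoped ContDiff

namespace Heisenberg

variable {n : ℕ}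

lemma radial (hn : 1 ≤ n) (g : ℝ → ℝ) :
    ∫ z : (Fin n → ℝ) × (Fin n → ℝ), g (∑ i, z.1 i ^ 2 + ∑ i, z.2 i ^ 2) =
    (n * (volume : Measure (EuclideanSpace ℝ (Ix n))).real (Metric.ball 0 1)) *
      ∫ s in Ioi (0 : ℝ), s ^ (n - 1) * g s := by
  have : Nonempty (Fin n) := ⟨⟨0, hn⟩⟩
  have h1 := volume_measurePreserving_sumPiEquivProdPi (ι := Fin n) (ι' := Fin n) (fun _ => ℝ)
  rw [← h1.integral_comp (MeasurableEquiv.measurableEmbedding _)]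
  rw [← (EuclideanSpace.volume_preserving_symm_measurableEquiv_toLp (Ix n)).integral_comp
    (MeasurableEquiv.measurableEmbedding _)]
  have e : ∀ x : EuclideanSpace ℝ (Ix n), g (∑ i, ((MeasurableEquiv.sumPiEquivProdPi fun _ => ℝ) ((MeasurableEquiv.toLp 2 (Ix n → ℝ)).symm x)).1 i ^ 2 +
      ∑ i, ((MeasurableEquiv.sumPiEquivProdPi fun _ => ℝ) ((MeasurableEquiv.toLp 2 (Ix n → ℝ)).symm x)).2 i ^ 2) = (fun y => g (y ^ 2)) ‖x‖ := by
    intro x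
    simp only [EuclideanSpace.norm_sq_eq, Fintype.sum_sum_type, Real.norm_eq_abs, sq_abs]
    rfl
  simp_rw [e]
  have h4 := integral_fun_norm_addHaar (volume : Measure (EuclideanSpace ℝ (Ix n))) (fun y => g (y ^ 2))
  refine h4.trans ?_
  have hd : Module.finrank ℝ (EuclideanSpace ℝ (Ix n)) = 2 * n := by
    simp [two_mul]
  rw [hd]
  have h3 := integral_comp_rpow_Ioi_of_pos (g := fun s : ℝ => s ^ (n - 1) * g s) (p := 2) (by norm_num)
  rw [← h3, nsmul_eq_mul, smul_eq_mul]
  have e2 : ∫ x in Ioi (0 : ℝ), ((2 : ℝ) * x ^ ((2 : ℝ) - 1)) • ((x ^ (2 : ℝ)) ^ (n - 1) * g (x ^ (2 : ℝ)))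
      = 2 * ∫ x in Ioi (0 : ℝ), x ^ (2 * n - 1) • g (x ^ 2) := by
    rw [← integral_const_mul]
    refine setIntegral_congr_fun measurableSet_Ioi fun x hx => ?_
    have h21 : (2 : ℝ) - 1 = 1 := by norm_num
    obtain ⟨m, rfl⟩ : ∃ m, n = m + 1 := ⟨n - 1, by omega⟩
    have e3 : 2 * (m + 1) - 1 = 2 * m + 1 := by omega
    simp only [h21, rpow_one, rpow_two, smul_eq_mul, e3, Nat.add_sub_cancel]
    ring
  rw [e2]
  push_cast
  ring

lemma polar (hn : 1 ≤ n) : ∃ C : ℝ, 0 < C ∧ ∀ Ψ : ℝ × ℝ → ℝ, Continuous Ψ → HasCompactSupport Ψ →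
    ∫ ξ : H n, Ψ (PP ξ) = C * ∫ p in HP, Ψ p * p.1 ^ (n - 1) := by
  refine ⟨n * (volume : Measure (EuclideanSpace ℝ (Ix n))).real (Metric.ball 0 1), ?_, ?_⟩
  · have : (0 : ℝ) < n := by exact_mod_cast hn
    have h2 : 0 < (volume : Measure (EuclideanSpace ℝ (Ix n))).real (Metric.ball 0 1) := by
      apply ENNReal.toReal_pos
      · exact (Metric.measure_ball_pos _ _ one_pos).ne'
      · exact measure_ball_lt_top.ne
    positivity
  · intro Ψ hΨ hc
    have hi : Integrable (fun ξ : H n => Ψ (PP ξ)) :=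
      (hΨ.comp contDiff_PP.continuous).integrable_of_hasCompactSupport (hcs_cyl hc)
    have h1 := (MeasureTheory.volume_preserving_prodAssoc (α₁ := Fin n → ℝ) (β₁ := Fin n → ℝ) (γ₁ := ℝ))
    have hi' := (h1.integrable_comp_emb (MeasurableEquiv.measurableEmbedding _)).2 hi
    rw [← h1.integral_comp (MeasurableEquiv.measurableEmbedding _)]
    rw [Measure.volume_eq_prod]
    rw [Measure.volume_eq_prod] at hi'
    refine (integral_prod_symm _ hi').trans ?_
    have hHP : (volume : Measure (ℝ × ℝ)).restrict HP
        = ((volume : Measure ℝ).restrict (Ioi 0)).prod (volume : Measure ℝ) := by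
      have : (HP : Set (ℝ × ℝ)) = Ioi (0 : ℝ) ×ˢ univ := by
        ext p; simp [HP]
      rw [this, Measure.volume_eq_prod, ← Measure.prod_restrict, Measure.restrict_univ]
    have hi2 : Integrable (fun p : ℝ × ℝ => Ψ p * p.1 ^ (n - 1))
        (((volume : Measure ℝ).restrict (Ioi 0)).prod (volume : Measure ℝ)) := by
      rw [← hHP]
      apply Integrable.integrableOn
      exact Continuous.integrable_of_hasCompactSupport (by fun_prop) hc.mul_right
    rw [hHP, integral_prod_symm _ hi2, ← integral_const_mul]
    congr 1; funext t
    have := radial hn (fun s => Ψ (s, t))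
    simp_rw [mul_comm (_ ^ (n - 1))] at this
    exact this

/-- Profile of a cylindrical function. -/
def prof (hn : 1 ≤ n) (u : H n → ℝ) (p : ℝ × ℝ) : ℝ := u (Pi.single ⟨0, hn⟩ (√p.1), 0, p.2)

lemma rsq_single (hn : 1 ≤ n) (r t : ℝ) : rsq ((Pi.single ⟨0, hn⟩ r, 0, t) : H n) = r ^ 2 := by
  simp [rsq, Pi.single_apply]

lemma prof_PP (hn : 1 ≤ n) {u : H n → ℝ} (h : IsCylindrical u) (ξ : H n) : u ξ = prof hn u (PP ξ) := by
  apply h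
  · rw [rsq_single, PP, Real.sq_sqrt (rsq_nonneg ξ)]
  · rfl

lemma continuous_prof (hn : 1 ≤ n) {u : H n → ℝ} (h : Continuous u) : Continuous (prof hn u) := by
  apply h.comp
  refine Continuous.prodMk ?_ (by fun_prop)
  exact (continuous_single _).comp (continuous_sqrt.comp continuous_fst)

lemma weakEq_of_sol (hn : 1 ≤ n) {w z : ℝ × ℝ → ℝ} {u F : H n → ℝ} (hu : Continuous u) (hF : Continuous F)
    (hw : Continuous w) (hz : Continuous z)
    (huw : ∀ ξ, u ξ = w (PP ξ)) (hFz : ∀ ξ, F ξ = z (PP ξ)) (h : IsWeakSol univ u F) :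
    WeakEq ((n : ℝ) / 2) (fun p => p.1 ^ ((n : ℝ) / 2) * w p)
      (fun p => -(1 / 4) * p.1 ^ ((n : ℝ) / 2 + 1) * z p) := by
  intro q hq Θ hΘ
  obtain ⟨C, hC, hP⟩ := polar hn
  set a : ℝ := (n : ℝ) / 2 with ha
  set ψ := tst (-a) q Θ with hψ
  have cψ : ContDiff ℝ ∞ ψ := contDiff_tst hq hΘ
  have sψ : HasCompactSupport ψ := hasCompactSupport_tst hq hΘ
  have cS := contDiff_dS cψ
  have cT := contDiff_dT cψ
  have sS : HasCompactSupport (dS ψ) := sψ.of_isClosed_subset (isClosed_tsupport _) (tsupport_dS ψ)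
  have sT : HasCompactSupport (dT ψ) := sψ.of_isClosed_subset (isClosed_tsupport _) (tsupport_dT ψ)
  have sSS : HasCompactSupport (dS (dS ψ)) := sS.of_isClosed_subset (isClosed_tsupport _) (tsupport_dS _)
  have sTT : HasCompactSupport (dT (dT ψ)) := sT.of_isClosed_subset (isClosed_tsupport _) (tsupport_dT _)
  have key := dist_cyl hu hF huw h cψ sψ
  simp_rw [hFz] at key
  have k1 := hP (fun p => w p * (4 * (p.1 * (dS (dS ψ) p + dT (dT ψ) p) + n * dS ψ p)))
    (by
      have := (contDiff_dS cS).continuous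
      have := (contDiff_dT cT).continuous
      have := cS.continuous
      fun_prop)
    (HasCompactSupport.mul_left (HasCompactSupport.mul_left
      (HasCompactSupport.add ((sSS.add sTT).mul_left) sS.mul_left)))
  have k2 := hP (fun p => z p * ψ p) (hz.mul cψ.continuous) sψ.mul_left
  have k3 : C * ∫ p in HP, w p * (4 * (p.1 * (dS (dS ψ) p + dT (dT ψ) p) + n * dS ψ p)) * p.1 ^ (n - 1)
      = -(C * ∫ p in HP, z p * ψ p * p.1 ^ (n - 1)) := by
    rw [← k1, ← k2]; exact key
  rw [← mul_neg] at k3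
  have k4 := mul_left_cancel₀ hC.ne' k3
  have pw : ∀ p ∈ HP, (p.1 : ℝ) ^ (n - 1) = p.1 ^ (2 * a - 1) := by
    intro p hp
    rw [← rpow_natCast]
    congr 1
    push_cast [hn]
    rw [ha]; ring
  have i1 : ∫ p in HP, (p.1 ^ a * w p) * (AA a Θ (xx q p) / p.1 ^ 2)
      = (1 / 4) * ∫ p in HP, w p * (4 * (p.1 * (dS (dS ψ) p + dT (dT ψ) p) + n * dS ψ p)) * p.1 ^ (n - 1) := by
    rw [← integral_const_mul]
    refine setIntegral_congr_fun isOpen_HP.measurableSet fun p hp => ?_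
    have hp0 : 0 < p.1 := hp
    have e := P_tst (a := a) hq hΘ hp
    have e2 : (n : ℝ) = 2 * a := by rw [ha]; ring
    rw [pw p hp, e2, ← hψ] at *
    rw [e]
    have e3 : p.1 ^ (-a - 1) * p.1 ^ (2 * a - 1) = p.1 ^ a / p.1 ^ 2 := by
      rw [← rpow_add hp0, ← rpow_natCast, ← rpow_sub hp0]; congr 1; push_cast; ring
    calc _ = w p * AA a Θ (xx q p) * (p.1 ^ a / p.1 ^ 2) := by ring
      _ = _ := by rw [← e3]; ring
  have i2 : ∫ p in HP, (-(1 / 4) * p.1 ^ (a + 1) * z p) * (Θ (xx q p) / p.1 ^ 2)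
      = -(1 / 4) * ∫ p in HP, z p * ψ p * p.1 ^ (n - 1) := by
    rw [← integral_const_mul]
    refine setIntegral_congr_fun isOpen_HP.measurableSet fun p hp => ?_
    have hp0 : 0 < p.1 := hp
    rw [pw p hp, hψ, tst_eq hp]
    have e3 : p.1 ^ (-a) * p.1 ^ (2 * a - 1) = p.1 ^ (a + 1) / p.1 ^ 2 := by
      rw [← rpow_add hp0, ← rpow_natCast, ← rpow_sub hp0]; congr 1; push_cast; ring
    calc _ = -(1 / 4) * z p * Θ (xx q p) * (p.1 ^ (a + 1) / p.1 ^ 2) := by ring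
      _ = _ := by rw [← e3]; ring
  rw [i1, i2, k4]; ring

end Heisenberg

end

section

open scoped ContDiff

namespace Heisenberg

variable {n : ℕ}

lemma gauge_four (ξ : H n) : gaugeH ξ ^ 4 = DD 0 (PP ξ) := by
  unfold gaugeH
  rw [← rpow_natCast, ← rpow_mul (by positivity)]
  simp [DD, PP]

lemma gauge_pow (ξ : H n) : gaugeH ξ ^ (2 * n) = DD 0 (PP ξ) ^ ((n : ℝ) / 2) := by
  unfold gaugeH
  rw [← rpow_natCast, ← rpow_mul (by positivity)]
  have : (4 : ℝ)⁻¹ * ((2 * n : ℕ) : ℝ) = (n : ℝ) / 2 := by push_cast; ring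
  rw [this]
  simp [DD, PP]

/-- inversion in the half plane -/
def inv0 (p : ℝ × ℝ) : ℝ × ℝ := (p.1 / DD 0 p, -p.2 / DD 0 p)

lemma PP_tilde (ξ : H n) : PP (tilde ξ) = inv0 (PP ξ) := by
  have h2 : (tilde ξ).2.2 = -ξ.2.2 / DD 0 (PP ξ) := by simp [tilde, gauge_four]
  have h1 : rsq (tilde ξ) = rsq ξ / DD 0 (PP ξ) := by
    have e : rsq (tilde ξ) = rsq ξ * DD 0 (PP ξ) / DD 0 (PP ξ) ^ 2 := by
      have e1 : rsq (tilde ξ) = ∑ i, ((ξ.1 i * ξ.2.2 + ξ.2.1 i * rsq ξ) / DD 0 (PP ξ)) ^ 2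
          + ∑ i, ((ξ.2.1 i * ξ.2.2 - ξ.1 i * rsq ξ) / DD 0 (PP ξ)) ^ 2 := by
        rw [rsq]; simp only [tilde, gauge_four]
      rw [e1, ← Finset.sum_add_distrib]
      have e2 : rsq ξ = ∑ i, (ξ.1 i ^ 2 + ξ.2.1 i ^ 2) := by rw [rsq, Finset.sum_add_distrib]
      have e3 : DD 0 (PP ξ) = rsq ξ ^ 2 + ξ.2.2 ^ 2 := by simp [DD, PP]
      conv_rhs => rw [e2, Finset.sum_mul, Finset.sum_div]
      refine Finset.sum_congr rfl fun i _ => ?_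
      rw [div_pow, div_pow, ← add_div]
      congr 1
      rw [e3]; ring
    rw [e]
    by_cases h0 : DD 0 (PP ξ) = 0
    · simp [h0]
    · field_simp
  unfold inv0
  rw [PP, h1, h2]; rfl

lemma crInv_eq (hn : 1 ≤ n) {u : H n → ℝ} (h : IsCylindrical u) (ξ : H n) :
    crInv u ξ = prof hn u (inv0 (PP ξ)) / DD 0 (PP ξ) ^ ((n : ℝ) / 2) := by
  rw [crInv, gauge_pow, prof_PP hn h, PP_tilde]

lemma PP_hRefl (l : ℝ) (ξ : H n) : PP (hRefl l ξ) = ((PP ξ).1, 2 * l - (PP ξ).2) := by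
  simp [PP, hRefl, rsq, add_comm]

/-- the Kelvin difference in the half plane -/
def KK (a l : ℝ) (w : ℝ × ℝ → ℝ) (p : ℝ × ℝ) : ℝ :=
  w (inv0 p) / DD 0 p ^ a - w (inv0 (p.1, 2 * l - p.2)) / DD 0 (p.1, 2 * l - p.2) ^ a

lemma Ulam_eq (hn : 1 ≤ n) {u : H n → ℝ} (h : IsCylindrical u) (l : ℝ) (ξ : H n) :
    Ulam u l ξ = KK ((n : ℝ) / 2) l (prof hn u) (PP ξ) := by
  rw [Ulam, crInv_eq hn h, crInv_eq hn h, PP_hRefl]; rfl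

lemma DD_refl (l : ℝ) (p : ℝ × ℝ) :
    DD 0 (p.1, 2 * l - p.2) = DD 0 p - 4 * l * p.2 + 4 * l ^ 2 := by
  simp only [DD]; ring

lemma inv0_mem {p : ℝ × ℝ} (hp : p ∈ HP) : inv0 p ∈ HP := div_pos hp (DD_pos hp)

lemma DD_inv0 {l : ℝ} (hl : 0 < l) {p : ℝ × ℝ} (hp : p ∈ HP) :
    DD (-(1 / (2 * l))) (inv0 p) = (1 / (2 * l)) ^ 2 * DD 0 (p.1, 2 * l - p.2) / DD 0 p := by
  have h := DD_pos (c := 0) hp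
  have e : p.1 ^ 2 = DD 0 p - p.2 ^ 2 := by simp [DD]
  rw [DD_refl]
  generalize hN : DD 0 p = N at *
  have : DD (-(1 / (2 * l))) (inv0 p) = p.1 ^ 2 / N ^ 2 + (-p.2 / N + 1 / (2 * l)) ^ 2 := by
    simp only [DD, inv0] at *; rw [hN]; ring
  rw [this, e]
  field_simp
  ring

lemma TT_inv0 {l : ℝ} (hl : 0 < l) {p : ℝ × ℝ} (hp : p ∈ HP) :
    TT (-(1 / (2 * l))) (1 / (2 * l)) (inv0 p) = inv0 (p.1, 2 * l - p.2) := by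
  have h := DD_pos (c := 0) hp
  have h' : 0 < DD 0 (p.1, 2 * l - p.2) := DD_pos (c := 0) (p := (p.1, 2 * l - p.2)) hp
  have e := DD_refl l p
  unfold TT
  rw [DD_inv0 hl hp]
  unfold inv0
  generalize DD 0 p = N at *
  generalize DD 0 (p.1, 2 * l - p.2) = M at *
  ext
  · simp only
    field_simp
  · simp only
    have : N = M + 4 * l * p.2 - 4 * l ^ 2 := by linarith
    field_simp
    rw [this]; ring

lemma KK_UU {a l : ℝ} (hl : 0 < l) {p : ℝ × ℝ} (hp : p ∈ HP) (w : ℝ × ℝ → ℝ) :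
    UU a (-(1 / (2 * l))) (1 / (2 * l)) w (inv0 p) = DD 0 p ^ a * KK a l w p := by
  have h := DD_pos (c := 0) hp
  have h' : 0 < DD 0 (p.1, 2 * l - p.2) := DD_pos (c := 0) (p := (p.1, 2 * l - p.2)) hp
  have e : (1 / (2 * l)) ^ 2 / ((1 / (2 * l)) ^ 2 * DD 0 (p.1, 2 * l - p.2) / DD 0 p)
    = DD 0 p / DD 0 (p.1, 2 * l - p.2) := by field_simp
  unfold UU KK
  rw [TT_inv0 hl hp, DD_inv0 hl hp, e, div_rpow h.le h'.le]
  have := rpow_pos_of_pos h a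
  have := rpow_pos_of_pos h' a
  field_simp

lemma cont_KK1 {a : ℝ} {w : ℝ × ℝ → ℝ} (hw : Continuous w) {p : ℝ × ℝ} (h : DD 0 p ≠ 0) :
    ContinuousAt (fun p => w (inv0 p) / DD 0 p ^ a) p := by
  have c := (continuous_DD 0).continuousAt (x := p)
  refine ContinuousAt.div (ContinuousAt.comp hw.continuousAt ?_) (c.rpow_const (Or.inl h)) ?_
  · exact (continuousAt_fst.div c h).prodMk (continuousAt_snd.neg.div c h)
  · exact (rpow_pos_of_pos (lt_of_le_of_ne (DD_nonneg 0 p) h.symm) a).ne'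

lemma KK_nonpos {a l : ℝ} (hl : 0 < l) {w : ℝ × ℝ → ℝ} (hw : Continuous w)
    (h : ∀ p ∈ HP, DD (-(1 / (2 * l))) p < (1 / (2 * l)) ^ 2 →
      UU a (-(1 / (2 * l))) (1 / (2 * l)) w p ≤ 0)
    {p : ℝ × ℝ} (h0 : 0 ≤ p.1) (hp : l < p.2) (hne : p ≠ (0, 2 * l)) : KK a l w p ≤ 0 := by
  have main : ∀ p ∈ HP, l < p.2 → KK a l w p ≤ 0 := by
    intro p hp hlt
    have hN := DD_pos (c := 0) hp
    have h1 := h _ (inv0_mem hp) (by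
      rw [DD_inv0 hl hp, mul_div_assoc]
      have : DD 0 (p.1, 2 * l - p.2) / DD 0 p < 1 := by
        rw [div_lt_one hN, DD_refl]; nlinarith
      have h3 : 0 < (1 / (2 * l)) ^ 2 := by positivity
      nlinarith)
    rw [KK_UU hl hp] at h1
    have := rpow_pos_of_pos hN a
    by_contra hc; push Not at hc
    nlinarith [mul_pos this hc]
  rcases h0.lt_or_eq with h0 | h0
  · exact main p h0 hp
  · have n1 : DD 0 p ≠ 0 := by
      have : 0 < p.2 := hl.trans hp
      have : 0 < DD 0 p := by simp only [DD, sub_zero]; positivity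
      exact this.ne'
    have n2 : DD 0 (p.1, 2 * l - p.2) ≠ 0 := by
      intro hc
      simp only [DD, ← h0, sub_zero] at hc
      apply hne
      have : 2 * l - p.2 = 0 := by
        have : (2 * l - p.2) ^ 2 = 0 := by simpa using hc
        exact pow_eq_zero_iff (two_ne_zero) |>.1 this
      ext
      · exact h0.symm
      · simp only; linarith
    have c1 : ContinuousAt (KK a l w) p := by
      apply (cont_KK1 hw n1).sub
      exact ContinuousAt.comp (f := fun p : ℝ × ℝ => (p.1, 2 * l - p.2)) (cont_KK1 hw n2) (by fun_prop)
    have c2 : ContinuousAt (fun s : ℝ => KK a l w (s, p.2)) 0 := by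
      have e : p = ((0 : ℝ), p.2) := by ext <;> simp [← h0]
      rw [e] at c1
      exact ContinuousAt.comp (f := fun s : ℝ => (s, p.2)) c1 (by fun_prop)
    have lim : Tendsto (fun s : ℝ => KK a l w (s, p.2)) (𝓝[>] 0) (𝓝 (KK a l w (0, p.2))) :=
      c2.tendsto.mono_left nhdsWithin_le_nhds
    have e : p = ((0 : ℝ), p.2) := by ext <;> simp [← h0]
    rw [e]
    refine le_of_tendsto lim ?_
    filter_upwards [self_mem_nhdsWithin] with s hs
    exact main (s, p.2) hs hp

end Heisenberg

end

namespace Heisenberg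

/-- **Lemma 3.3.** Under the assumptions of Theorem 1.1, there exists `λ₀ > 0` such that
for all `λ ≥ λ₀`, `U_λ(ξ) ≤ 0` and `V_λ(ξ) ≤ 0` for all `ξ ∈ Σ_λ ∖ {0_λ}`. -/
theorem moving_plane_start (n : ℕ) (hn : 1 ≤ n)
    (u v : H n → ℝ) (f g : ℝ → ℝ)
    (hu_cont : Continuous u) (hv_cont : Continuous v)
    (hu_pos : ∀ ξ, 0 < u ξ) (hv_pos : ∀ ξ, 0 < v ξ)
    (hu_cyl : IsCylindrical u) (hv_cyl : IsCylindrical v)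
    (hu_sol : IsWeakSol Set.univ u (fun ξ => f (v ξ)))
    (hv_sol : IsWeakSol Set.univ v (fun ξ => g (u ξ)))
    (hf_cont : ContinuousOn f (Set.Ici 0))
    (hg_cont : ContinuousOn g (Set.Ici 0))
    (hf_mono : ∀ s t : ℝ, 0 < s → s ≤ t → f s ≤ f t)
    (hg_mono : ∀ s t : ℝ, 0 < s → s ≤ t → g s ≤ g t)
    (hh_anti : ∀ s t : ℝ, 0 < s → s ≤ t → f t / t ^ tau n ≤ f s / s ^ tau n)
    (hk_anti : ∀ s t : ℝ, 0 < s → s ≤ t → g t / t ^ tau n ≤ g s / s ^ tau n) :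
    ∃ l₀ : ℝ, 0 < l₀ ∧ ∀ l : ℝ, l₀ ≤ l →
      ∀ ξ ∈ Sig (n := n) l, ξ ≠ zl l → Ulam u l ξ ≤ 0 ∧ Ulam v l ξ ≤ 0 := by
  have nf : Nice n f := ⟨hf_cont, hf_mono, hh_anti⟩
  have ng : Nice n g := ⟨hg_cont, hg_mono, hk_anti⟩
  have cw := continuous_prof hn hu_cont
  have cv := continuous_prof hn hv_cont
  have pw : ∀ p, 0 < prof hn u p := fun p => hu_pos _
  have pv : ∀ p, 0 < prof hn v p := fun p => hv_pos _
  have e1 := prof_PP hn hu_cyl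
  have e2 := prof_PP hn hv_cyl
  have cF : Continuous (fun ξ => f (v ξ)) := by
    have := (nf.cont_comp cv pv).comp (contDiff_PP (n := n)).continuous
    refine this.congr fun ξ => ?_
    simp [← e2]
  have cG : Continuous (fun ξ => g (u ξ)) := by
    have := (ng.cont_comp cw pw).comp (contDiff_PP (n := n)).continuous
    refine this.congr fun ξ => ?_
    simp [← e1]
  have W1 := weakEq_of_sol hn hu_cont cF cw (nf.cont_comp cv pv) e1 (fun ξ => by rw [← e2]) hu_sol
  have W2 := weakEq_of_sol hn hv_cont cG cv (ng.cont_comp cw pw) e2 (fun ξ => by rw [← e1]) hv_sol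
  obtain ⟨ρ₀, hρ, key⟩ := comparison hn nf ng cw pw cv pv W1 W2
  refine ⟨1 / (2 * ρ₀), by positivity, fun l hl ξ hξ hne => ?_⟩
  have l0 : 0 < l := lt_of_lt_of_le (by positivity) hl
  have k := key (1 / (2 * l)) (by positivity) (by
    rw [div_le_iff₀ (by positivity)] at hl ⊢
    linarith)
  have hne' : PP ξ ≠ (0, 2 * l) := by
    intro hc
    apply hne
    have h1 : rsq ξ = 0 := congrArg Prod.fst hc
    have h2 : ξ.2.2 = 2 * l := congrArg Prod.snd hc
    rw [rsq_eq, Finset.sum_eq_zero_iff_of_nonneg (fun _ _ => sq_nonneg _)] at h1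
    have h3 : ∀ k : Ix n, xc k ξ = 0 := fun k => by
      have := h1 k (Finset.mem_univ k)
      exact pow_eq_zero_iff two_ne_zero |>.1 this
    refine Prod.ext (funext fun i => h3 (Sum.inl i)) (Prod.ext (funext fun i => h3 (Sum.inr i)) h2)
  rw [Ulam_eq hn hu_cyl, Ulam_eq hn hv_cyl]
  exact ⟨KK_nonpos l0 cw (fun p hp h => (k p hp h).1) (rsq_nonneg ξ) hξ hne',
    KK_nonpos l0 cv (fun p hp h => (k p hp h).2) (rsq_nonneg ξ) hξ hne'⟩

end Heisenberg
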